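/- Let d, m ≥ 1, r⃗ ∈ (0,∞)^m, q ∈ (0,∞), s ∈ (q,∞], and set ρ := (1/q − 1/s)^{-1}. Let T be a map assigning to each m-tuple of simple, bounded, compactly supported functions on ℝ^d a measurable function on ℝ^d, and suppose there is C_T ≥ 0 such that ‖T(f⃗)·g‖_{L^q(ℝ^d)} ≤ C_T ‖M_{(r_1,…,r_m,ρ)}(f_1,…,f_m,g)‖_{L^q(ℝ^d)} for all simple f_j ∈ L^∞_c(ℝ^d) and all g ∈ L^∞_c(ℝ^d). Then for all p⃗ ∈ (0,∞]^m with r_j < p_j for all j and p < s (where 1/p := ∑_{j=1}^m 1/p_j) and all w⃗ ∈ A_{p⃗,(r⃗,s)}, there is a constant C depending only on d, m, p⃗, q, r⃗, s such that ‖T(f⃗)‖_{L^p_w(ℝ^d)} ≤ C · C_T · [w⃗]_{p⃗,(r⃗,s)}^{max{ max_{1≤j≤m} (1/r_j)/(1/r_j − 1/p_j), (1/q − 1/s)/(1/p − 1/s) }} · ∏_{j=1}^m ‖f_j‖_{L^{p_j}_{w_j}(ℝ^d)} for all simple f_j ∈ L^∞_c(ℝ^d), where w := ∏_{j=1}^m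 w_j. -/

import Mathlib

open MeasureTheory ENNReal

noncomputable section

structure Cube (d : ℕ) where
  corner : Fin d → ℝ
  side : ℝ
  side_pos : 0 < side

namespace Cube
def set {d : ℕ} (Q : Cube d) : Set (Fin d → ℝ) :=
  {x | ∀ i, Q.corner i ≤ x i ∧ x i < Q.corner i + Q.side}
def vol {d : ℕ} (Q : Cube d) : ℝ≥0∞ := volume Q.set
def IsDyadic {d : ℕ} (Q : Cube d) : Prop :=
  ∃ (k : ℤ) (n : Fin d → ℤ), Q.side = (2:ℝ) ^ (-k) ∧ ∀ i, Q.corner i = (2:ℝ) ^ (-k) * (n i : ℝ)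
end Cube

def IsSparse {d : ℕ} (S : Set (Cube d)) : Prop :=
  ∃ E : Cube d → Set (Fin d → ℝ),
    (∀ Q ∈ S, MeasurableSet (E Q) ∧ E Q ⊆ Q.set ∧ Q.vol ≤ 2 * volume (E Q)) ∧
    S.PairwiseDisjoint E

def eNorm {α : Type*} [MeasurableSpace α] (p : ℝ≥0∞) (μ : Measure α) (F : α → ℝ≥0∞) : ℝ≥0∞ :=
  if p = ∞ then essSup F μ else (∫⁻ x, F x ^ p.toReal ∂μ) ^ (1 / p.toReal)

def nn {α : Type*} (f : α → ℂ) : α → ℝ≥0∞ := fun x => (‖f x‖₊ : ℝ≥0∞)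

def avg {d : ℕ} (r : ℝ≥0∞) (F : (Fin d → ℝ) → ℝ≥0∞) (Q : Cube d) : ℝ≥0∞ :=
  if r = ∞ then essSup F (volume.restrict Q.set)
  else ((∫⁻ x in Q.set, F x ^ r.toReal) / Q.vol) ^ (1 / r.toReal)

def maximal {d k : ℕ} (r : Fin k → ℝ≥0∞) (F : Fin k → (Fin d → ℝ) → ℝ≥0∞)
    (x : Fin d → ℝ) : ℝ≥0∞ :=
  ⨆ (Q : Cube d) (_ : x ∈ Q.set), ∏ j, avg (r j) (F j) Q

def maximalX {d k : ℕ} (r : Fin k → ℝ≥0∞) (ρ : ℝ≥0∞) (F : Fin k → (Fin d → ℝ) → ℝ≥0∞)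
    (G : (Fin d → ℝ) → ℝ≥0∞) (x : Fin d → ℝ) : ℝ≥0∞ :=
  ⨆ (Q : Cube d) (_ : x ∈ Q.set), (∏ j, avg (r j) (F j) Q) * avg ρ G Q

def wNorm {d : ℕ} (p : ℝ≥0∞) (w : (Fin d → ℝ) → ℝ) (F : (Fin d → ℝ) → ℝ≥0∞) : ℝ≥0∞ :=
  eNorm p volume (fun x => F x * ENNReal.ofReal (w x))

def aConst {d m : ℕ} (p r : Fin m → ℝ≥0∞) (s : ℝ≥0∞)
    (w : Fin m → (Fin d → ℝ) → ℝ) : ℝ≥0∞ :=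
  ⨆ Q : Cube d,
    (∏ j, avg ((r j)⁻¹ - (p j)⁻¹)⁻¹ (fun x => ENNReal.ofReal (w j x)⁻¹) Q) *
      avg ((∑ j, (p j)⁻¹) - s⁻¹)⁻¹ (fun x => ENNReal.ofReal (∏ j, w j x)) Q

def latAvg {d : ℕ} {Ω : Type*} (r : ℝ≥0∞) (f : (Fin d → ℝ) → Ω → ℂ) (Q : Cube d) (ω : Ω) : ℝ≥0∞ :=
  ((∫⁻ y in Q.set, (‖f y ω‖₊ : ℝ≥0∞) ^ r.toReal) / Q.vol) ^ (1 / r.toReal)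

def latMax {d m : ℕ} {Ω : Type*} (r : Fin m → ℝ≥0∞) (D : Finset (Cube d))
    (f : Fin m → (Fin d → ℝ) → Ω → ℂ) (x : Fin d → ℝ) (ω : Ω) : ℝ≥0∞ :=
  ⨆ Q ∈ D, ⨆ (_ : x ∈ Cube.set Q), ∏ j, latAvg (r j) (f j) Q ω

def latMaxX {d m : ℕ} {Ω : Type*} (r : Fin m → ℝ≥0∞) (ρ : ℝ≥0∞) (D : Finset (Cube d))
    (f : Fin m → (Fin d → ℝ) → Ω → ℂ) (g : (Fin d → ℝ) → Ω → ℂ)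
    (x : Fin d → ℝ) (ω : Ω) : ℝ≥0∞ :=
  ⨆ Q ∈ D, ⨆ (_ : x ∈ Cube.set Q), (∏ j, latAvg (r j) (f j) Q ω) * latAvg ρ g Q ω

def MemLinftyC {d : ℕ} (f : (Fin d → ℝ) → ℂ) : Prop :=
  Measurable f ∧ (∃ M : ℝ, ∀ x, ‖f x‖ ≤ M) ∧ Bornology.IsBounded (Function.support f)

def SimpleLinftyC {d : ℕ} (f : (Fin d → ℝ) → ℂ) : Prop :=
  Measurable f ∧ (Set.range f).Finite ∧ Bornology.IsBounded (Function.support f)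

def PairSimple {d : ℕ} {Ω : Type*} [MeasurableSpace Ω] (f : (Fin d → ℝ) → Ω → ℂ) : Prop :=
  Measurable (Function.uncurry f) ∧ (Set.range (Function.uncurry f)).Finite ∧
    ∃ B : Set (Fin d → ℝ), Bornology.IsBounded B ∧ ∀ x ∉ B, ∀ ω, f x ω = 0

def VecSimple {d : ℕ} {Ω : Type*} [MeasurableSpace Ω] (f : (Fin d → ℝ) → Ω → ℂ) : Prop :=
  ∃ (N : ℕ) (A : Fin N → Set (Fin d → ℝ)) (ξ : Fin N → Ω → ℂ),
    (∀ i, MeasurableSet (A i)) ∧ (∀ i, Bornology.IsBounded (A i)) ∧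
    (∀ i, Measurable (ξ i)) ∧ (∃ M : ℝ, ∀ i ω, ‖ξ i ω‖ ≤ M) ∧
    ∀ x ω, f x ω = ∑ i, (A i).indicator (fun _ => ξ i ω) x

namespace S7

variable {X : Type*}

/-- Laminar families of sets. -/
def Lam (D : Set (Set X)) : Prop := ∀ Q ∈ D, ∀ R ∈ D, Q ⊆ R ∨ R ⊆ Q ∨ Disjoint Q R

/-- Maximal function of a set function over a family. -/
def mx (D : Set (Set X)) (a : Set X → ℝ≥0∞) (x : X) : ℝ≥0∞ :=
  ⨆ Q ∈ D, Q.indicator (fun _ => a Q) x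

theorem Lam.mono {D D' : Set (Set X)} (h : Lam D) (h' : D' ⊆ D) : Lam D' :=
  fun Q hQ R hR => h Q (h' hQ) R (h' hR)

theorem le_mx {D : Set (Set X)} (a : Set X → ℝ≥0∞) {x : X} {Q : Set X} (hQ : Q ∈ D) (hx : x ∈ Q) :
    a Q ≤ mx D a x := by
  have : a Q = Q.indicator (fun _ => a Q) x := by simp [hx]
  rw [this]
  exact le_iSup₂_of_le (f := fun Q (_ : Q ∈ D) => Q.indicator (fun _ => a Q) x) Q hQ le_rfl

theorem mx_le {D : Set (Set X)} {a : Set X → ℝ≥0∞} {x : X} {B : ℝ≥0∞}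
    (h : ∀ Q ∈ D, x ∈ Q → a Q ≤ B) : mx D a x ≤ B := by
  refine iSup₂_le fun Q hQ => ?_
  by_cases hx : x ∈ Q
  · simpa [hx] using h Q hQ hx
  · simp [hx]

theorem mx_mono {D D' : Set (Set X)} (a : Set X → ℝ≥0∞) (h : D ⊆ D') (x : X) :
    mx D a x ≤ mx D' a x := mx_le fun _ hQ hx => le_mx a (h hQ) hx

theorem lt_mx {D : Set (Set X)} {a : Set X → ℝ≥0∞} {x : X} {B : ℝ≥0∞} :
    B < mx D a x ↔ ∃ Q ∈ D, x ∈ Q ∧ B < a Q := by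
  constructor
  · intro h
    by_contra! hc
    exact absurd (mx_le hc) (not_le.2 h)
  · rintro ⟨Q, hQ, hx, hB⟩
    exact hB.trans_le (le_mx a hQ hx)

theorem kernel (a : Set X → ℝ≥0∞) (A : ℝ≥0∞) (hA : 1 ≤ A) (F : Finset (Set X)) :
    ∃ S ⊆ F, (∀ Q ∈ F, ∃ R ∈ S, Q ⊆ R ∧ a Q ≤ A * a R) ∧
      (∀ Q ∈ S, ∀ R ∈ S, Q ⊂ R → A * a R < a Q) := by
  classical
  induction F using Finset.strongInduction with
  | H F ih =>
    rcases F.eq_empty_or_nonempty with rfl | hne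
    · exact ⟨∅, by simp⟩
    obtain ⟨Q0, hQ0⟩ := Finset.exists_minimal hne
    obtain ⟨S, hSF, h1, h2⟩ := ih (F.erase Q0) (Finset.erase_ssubset hQ0.prop)
    by_cases hc : ∃ R ∈ S, Q0 ⊆ R ∧ a Q0 ≤ A * a R
    · refine ⟨S, hSF.trans (Finset.erase_subset _ _), fun Q hQ => ?_, h2⟩
      by_cases hQQ : Q = Q0
      · rw [hQQ]; exact hc
      · exact h1 Q (Finset.mem_erase.2 ⟨hQQ, hQ⟩)
    · push Not at hc
      refine ⟨insert Q0 S, ?_, fun Q hQ => ?_, ?_⟩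
      · exact Finset.insert_subset hQ0.prop (hSF.trans (Finset.erase_subset _ _))
      · by_cases hQQ : Q = Q0
        · refine ⟨Q0, Finset.mem_insert_self _ _, hQQ.le, ?_⟩
          rw [hQQ]
          exact le_mul_of_one_le_left' hA
        · obtain ⟨R, hR, h⟩ := h1 Q (Finset.mem_erase.2 ⟨hQQ, hQ⟩)
          exact ⟨R, Finset.mem_insert_of_mem hR, h⟩
      · intro Q hQ R hR hQR
        rcases Finset.mem_insert.1 hQ with rfl | hQ'
        · rcases Finset.mem_insert.1 hR with rfl | hR'
          · exact absurd hQR (ssubset_irrefl _)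
          · exact hc R hR' hQR.subset
        · rcases Finset.mem_insert.1 hR with rfl | hR'
          · have hQF := Finset.mem_of_mem_erase (hSF hQ')
            exact absurd (hQ0.2 hQF hQR.subset) hQR.2
          · exact h2 Q hQ' R hR' hQR

variable [MeasurableSpace X]

theorem measurable_mx {D : Set (Set X)} (hD : D.Countable) (hm : ∀ Q ∈ D, MeasurableSet Q)
    (a : Set X → ℝ≥0∞) : Measurable (mx D a) := by
  unfold mx
  exact Measurable.biSup D hD fun Q hQ => measurable_const.indicator (hm Q hQ)

theorem weak {μ ν : Measure X} (G : Finset (Set X)) (hL : Lam (G : Set (Set X)))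
    (hm : ∀ Q ∈ G, MeasurableSet Q) (c : ℝ≥0∞) (h : ∀ Q ∈ G, c * μ Q ≤ ν Q) :
    c * μ (⋃ Q ∈ G, Q) ≤ ν (⋃ Q ∈ G, Q) := by
  classical
  set M := G.filter (fun Q => Maximal (fun x => x ∈ G) Q) with hM
  have hU : (⋃ Q ∈ G, Q) = ⋃ Q ∈ M, Q := by
    apply Set.Subset.antisymm
    · refine Set.iUnion₂_subset fun Q hQ => ?_
      obtain ⟨b, hb, hb'⟩ := Finset.exists_le_maximal G hQ
      refine Set.Subset.trans hb ?_
      exact Set.subset_biUnion_of_mem (u := fun x => x)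
        (show b ∈ (M : Set (Set X)) from by simp [hM, hb', hb'.prop])
    · refine Set.iUnion₂_subset fun Q hQ => ?_
      exact Set.subset_biUnion_of_mem (u := fun x => x)
        (show Q ∈ (G : Set (Set X)) from (Finset.mem_filter.1 hQ).1)
  have hd : (M : Set (Set X)).PairwiseDisjoint (fun x => x) := by
    intro Q hQ R hR hne
    have hQ' := Finset.mem_filter.1 hQ
    have hR' := Finset.mem_filter.1 hR
    rcases hL Q hQ'.1 R hR'.1 with h1 | h1 | h1
    · exact absurd (Set.Subset.antisymm h1 (hQ'.2.2 hR'.1 h1)) hne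
    · exact absurd (Set.Subset.antisymm (hR'.2.2 hQ'.1 h1) h1) hne
    · exact h1
  rw [hU, measure_biUnion_finset hd fun b hb => hm b (Finset.mem_filter.1 hb).1,
    measure_biUnion_finset hd fun b hb => hm b (Finset.mem_filter.1 hb).1, Finset.mul_sum]
  exact Finset.sum_le_sum fun Q hQ => h Q (Finset.mem_filter.1 hQ).1

theorem sparse {μ : Measure X} (a : Set X → ℝ≥0∞) (A : ℝ≥0∞) (hA : 1 ≤ A) (F : Finset (Set X))
    (hL : Lam (F : Set (Set X)))
    (hm : ∀ Q ∈ F, MeasurableSet Q) (hfin : ∀ Q ∈ F, μ Q ≠ ∞)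
    (hst : ∀ S ∈ F, 2 * μ (⋃ Q ∈ {Q ∈ (F : Set (Set X)) | Q ⊆ S ∧ A * a S < a Q}, Q) ≤ μ S) :
    ∃ S ⊆ F, ∃ E : Set X → Set X, (∀ Q ∈ F, ∃ R ∈ S, Q ⊆ R ∧ a Q ≤ A * a R) ∧
      (∀ Q ∈ S, MeasurableSet (E Q) ∧ E Q ⊆ Q ∧ μ Q ≤ 2 * μ (E Q)) ∧
      (S : Set (Set X)).PairwiseDisjoint E := by
  classical
  obtain ⟨S, hSF, h1, h2⟩ := kernel a A hA F
  refine ⟨S, hSF, fun S => S \ ⋃ Q ∈ {Q ∈ (F : Set (Set X)) | Q ⊆ S ∧ A * a S < a Q}, Q, h1, ?_, ?_⟩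
  · intro R hR
    have hRF := hSF hR
    set U := ⋃ Q ∈ {Q ∈ (F : Set (Set X)) | Q ⊆ R ∧ A * a R < a Q}, Q with hU
    have hUm : MeasurableSet U :=
      MeasurableSet.biUnion (F.finite_toSet.subset (Set.sep_subset _ _)).countable
        fun Q hQ => hm Q hQ.1
    refine ⟨(hm R hRF).diff hUm, Set.sdiff_subset, ?_⟩
    have hst' := hst R hRF
    have hle : μ R ≤ μ (R \ U) + μ U := by
      calc μ R ≤ μ ((R \ U) ∪ U) := measure_mono (by simp)
        _ ≤ _ := measure_union_le _ _
    have h3 : μ R + μ R ≤ 2 * μ (R \ U) + μ R := by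
      calc μ R + μ R = 2 * μ R := by ring
        _ ≤ 2 * (μ (R \ U) + μ U) := by gcongr
        _ = 2 * μ (R \ U) + 2 * μ U := by ring
        _ ≤ _ := by gcongr
    exact (ENNReal.add_le_add_iff_right (hfin R hRF)).1 h3
  · have key : ∀ Q ∈ S, ∀ R ∈ S, Q ⊂ R →
        Disjoint Q (R \ ⋃ Q ∈ {Q ∈ (F : Set (Set X)) | Q ⊆ R ∧ A * a R < a Q}, Q) := by
      intro Q hQ R hR hQR
      refine Set.disjoint_left.2 fun x hx hx' => hx'.2 ?_
      exact Set.mem_biUnion (show Q ∈ {Q ∈ (F : Set (Set X)) | Q ⊆ R ∧ A * a R < a Q} from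
        ⟨hSF hQ, hQR.subset, h2 Q hQ R hR hQR⟩) hx
    intro Q hQ R hR hne
    rcases hL Q (hSF hQ) R (hSF hR) with h | h | h
    · exact (key Q hQ R hR (h.ssubset_of_ne hne)).mono_left Set.sdiff_subset
    · exact (key R hR Q hQ (h.ssubset_of_ne hne.symm)).symm.mono_right Set.sdiff_subset
    · exact h.mono Set.sdiff_subset Set.sdiff_subset

/-- Set function given by product of averages. -/
def pav {ι : Type*} [Fintype ι] (μ : Measure X) (I : ι → Measure X) (e : ι → ℝ) (Q : Set X) : ℝ≥0∞ :=
  ∏ j, (I j Q / μ Q) ^ e j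

/-- the stopping constant -/
def Aconst {ι : Type*} [Fintype ι] (e : ι → ℝ) : ℝ≥0∞ :=
  ∏ j, (2 * ((Fintype.card ι : ℝ≥0∞) + 1)) ^ e j

theorem Aconst_ge {ι : Type*} [Fintype ι] (e : ι → ℝ) (he : ∀ j, 0 < e j) : 1 ≤ Aconst e := by
  unfold Aconst
  refine Finset.one_le_prod' fun j _ => ?_
  apply ENNReal.one_le_rpow _ (he j)
  calc (1 : ℝ≥0∞) ≤ 2 * (0 + 1) := by norm_num
    _ ≤ _ := by gcongr; exact zero_le

theorem Aconst_ne {ι : Type*} [Fintype ι] (e : ι → ℝ) (he : ∀ j, 0 < e j) : Aconst e ≠ ∞ := by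
  unfold Aconst
  refine ENNReal.prod_ne_top fun j _ => ?_
  apply ENNReal.rpow_ne_top_of_nonneg (he j).le
  finiteness

theorem pav_stop {ι : Type*} [Fintype ι] {μ : Measure X} {I : ι → Measure X} {e : ι → ℝ}
    (he : ∀ j, 0 < e j) (F : Finset (Set X)) (hL : Lam (F : Set (Set X)))
    (hm : ∀ Q ∈ F, MeasurableSet Q) (h0 : ∀ Q ∈ F, μ Q ≠ 0) (hfin : ∀ Q ∈ F, μ Q ≠ ∞)
    (S : Set X) (hS : S ∈ F) :
    2 * μ (⋃ Q ∈ {Q ∈ (F : Set (Set X)) | Q ⊆ S ∧ Aconst e * pav μ I e S < pav μ I e Q}, Q)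
      ≤ μ S := by
  classical
  set B : ℝ≥0∞ := 2 * ((Fintype.card ι : ℝ≥0∞) + 1) with hB
  have hBt : B ≠ ∞ := by rw [hB]; finiteness
  have hB0 : B ≠ 0 := by rw [hB]; simp
  let G : ι → Finset (Set X) := fun j => F.filter fun Q => Q ⊆ S ∧ B * (I j S / μ S) < I j Q / μ Q
  have hsub : (⋃ Q ∈ {Q ∈ (F : Set (Set X)) | Q ⊆ S ∧ Aconst e * pav μ I e S < pav μ I e Q}, Q) ⊆
      ⋃ j ∈ (Finset.univ : Finset ι), ⋃ Q ∈ G j, Q := by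
    refine Set.iUnion₂_subset fun Q hQ => ?_
    have : ∃ j, B * (I j S / μ S) < I j Q / μ Q := by
      by_contra! hc
      refine absurd hQ.2.2 (not_lt.2 ?_)
      unfold Aconst pav
      rw [← Finset.prod_mul_distrib]
      refine Finset.prod_le_prod' fun j _ => ?_
      rw [← ENNReal.mul_rpow_of_nonneg _ _ (he j).le]
      exact ENNReal.rpow_le_rpow (hc j) (he j).le
    obtain ⟨j, hj⟩ := this
    intro x hx
    simp only [Set.mem_iUnion]
    exact ⟨j, Finset.mem_univ _, Q, Finset.mem_filter.2 ⟨hQ.1, hQ.2.1, hj⟩, hx⟩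
  have hG : ∀ j, B * μ (⋃ Q ∈ G j, Q) ≤ μ S := by
    intro j
    rcases (G j).eq_empty_or_nonempty with hemp | ⟨Q0, hQ0⟩
    · simp [hemp]
    have hQ0' := (Finset.mem_filter.1 hQ0).2
    have hlt : B * (I j S / μ S) < ∞ := hQ0'.2.trans_le le_top
    have hIne : I j S ≠ ∞ := by
      intro h
      rw [h, ENNReal.top_div_of_ne_top (hfin S hS), ENNReal.mul_top hB0] at hlt
      exact lt_irrefl _ hlt
    have hI0 : I j S ≠ 0 := by
      intro h
      have : I j Q0 = 0 := measure_mono_null hQ0'.1 h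
      have h2 := hQ0'.2
      simp [this] at h2
    have hw := weak (μ := μ) (ν := I j) (G j) (hL.mono (Finset.coe_subset.2 (Finset.filter_subset _ _)))
      (fun Q hQ => hm Q (Finset.mem_filter.1 hQ).1) (B * (I j S / μ S)) (fun Q hQ => by
        have h := Finset.mem_filter.1 hQ
        exact (ENNReal.le_div_iff_mul_le (Or.inl (h0 Q h.1)) (Or.inl (hfin Q h.1))).1 h.2.2.le)
    have hw2 : (B * (I j S / μ S)) * μ (⋃ Q ∈ G j, Q) ≤ I j S := by
      refine hw.trans (measure_mono (Set.iUnion₂_subset fun Q hQ => ?_))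
      exact (Finset.mem_filter.1 hQ).2.1
    have hw3 : (B * μ (⋃ Q ∈ G j, Q)) * (I j S / μ S) ≤ I j S := by
      calc _ = (B * (I j S / μ S)) * μ (⋃ Q ∈ G j, Q) := by ring
        _ ≤ _ := hw2
    have hd0 : I j S / μ S ≠ 0 := by simp [ENNReal.div_eq_zero_iff, hI0, hfin S hS]
    have hdt : I j S / μ S ≠ ∞ := ENNReal.div_ne_top hIne (h0 S hS)
    have hw4 := (ENNReal.le_div_iff_mul_le (Or.inl hd0) (Or.inl hdt)).2 hw3
    refine hw4.trans_eq ?_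
    refine le_antisymm ?_ ?_
    · refine ENNReal.div_le_of_le_mul ?_
      rw [ENNReal.mul_div_cancel (h0 S hS) (hfin S hS)]
    · rw [ENNReal.le_div_iff_mul_le (Or.inl hd0) (Or.inl hdt),
        ENNReal.mul_div_cancel (h0 S hS) (hfin S hS)]
  have hsum : μ (⋃ Q ∈ {Q ∈ (F : Set (Set X)) | Q ⊆ S ∧ Aconst e * pav μ I e S < pav μ I e Q}, Q)
      ≤ ∑ j : ι, μ (⋃ Q ∈ G j, Q) :=
    (measure_mono hsub).trans (measure_biUnion_finset_le _ _)
  have h5 : B * μ (⋃ Q ∈ {Q ∈ (F : Set (Set X)) | Q ⊆ S ∧ Aconst e * pav μ I e S < pav μ I e Q}, Q)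
      ≤ ((Fintype.card ι : ℝ≥0∞) + 1) * μ S := by
    calc _ ≤ B * ∑ j : ι, μ (⋃ Q ∈ G j, Q) := by gcongr
      _ = ∑ j : ι, B * μ (⋃ Q ∈ G j, Q) := by rw [Finset.mul_sum]
      _ ≤ ∑ j : ι, μ S := Finset.sum_le_sum fun j _ => hG j
      _ = (Fintype.card ι : ℝ≥0∞) * μ S := by simp
      _ ≤ _ := by gcongr; exact le_self_add
  have hc0 : (Fintype.card ι : ℝ≥0∞) + 1 ≠ 0 := by simp
  have hct : (Fintype.card ι : ℝ≥0∞) + 1 ≠ ∞ := by finiteness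
  rw [hB, mul_comm 2, mul_assoc] at h5
  exact (ENNReal.mul_le_mul_iff_right hc0 hct).1 h5

end S7

namespace S7

variable {X : Type*} [MeasurableSpace X]

theorem layercake (ν : Measure X) {h : X → ℝ≥0∞} (hm : Measurable h) (hf : ∀ x, h x ≠ ∞) {u : ℝ}
    (hu : 0 < u) : ∫⁻ x, h x ^ u ∂ν =
      ENNReal.ofReal u * ∫⁻ t in Set.Ioi (0:ℝ), ν {x | ENNReal.ofReal t < h x} *
        ENNReal.ofReal (t ^ (u - 1)) := by
  have h1 := lintegral_rpow_eq_lintegral_meas_lt_mul ν (f := fun x => (h x).toReal)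
    (Filter.Eventually.of_forall fun x => ENNReal.toReal_nonneg) hm.ennreal_toReal.aemeasurable hu
  have h2 : ∀ x, ENNReal.ofReal ((h x).toReal ^ u) = h x ^ u := by
    intro x
    rw [← ENNReal.ofReal_rpow_of_nonneg ENNReal.toReal_nonneg hu.le, ENNReal.ofReal_toReal (hf x)]
  simp only [h2] at h1
  rw [h1]
  congr 1
  refine setLIntegral_congr_fun measurableSet_Ioi fun t ht => ?_
  congr 2
  ext x
  simp only [Set.mem_ofPred_eq]
  exact (ENNReal.ofReal_lt_iff_lt_toReal (le_of_lt ht) (hf x)).symm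

theorem mx_ne_top (F : Finset (Set X)) {a : Set X → ℝ≥0∞} (ha : ∀ Q ∈ F, a Q ≠ ∞) (x : X) :
    mx (F : Set (Set X)) a x ≠ ∞ := by
  refine ne_top_of_le_ne_top (ENNReal.sum_ne_top.2 ha) (mx_le fun Q hQ _ => ?_)
  exact Finset.single_le_sum (f := a) (fun _ _ => zero_le) hQ

theorem mx_level (F : Finset (Set X)) (a : Set X → ℝ≥0∞) (t : ℝ≥0∞) [DecidablePred fun Q => t < a Q] :
    {x | t < mx (F : Set (Set X)) a x} = ⋃ Q ∈ F.filter (fun Q => t < a Q), Q := by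
  ext x
  simp only [Set.mem_ofPred_eq, lt_mx, Set.mem_iUnion, Finset.mem_filter, Finset.mem_coe]
  constructor
  · rintro ⟨Q, h1, h2, h3⟩; exact ⟨Q, ⟨h1, h3⟩, h2⟩
  · rintro ⟨Q, ⟨h1, h3⟩, h2⟩; exact ⟨Q, h1, h2, h3⟩

/-- weak type bound for ratio of two measures -/
theorem mx_weak {ν I : Measure X} (F : Finset (Set X)) (hL : Lam (F : Set (Set X)))
    (hm : ∀ Q ∈ F, MeasurableSet Q) (h0 : ∀ Q ∈ F, ν Q ≠ 0) (hfin : ∀ Q ∈ F, ν Q ≠ ∞) (t : ℝ≥0∞) :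
    t * ν {x | t < mx (F : Set (Set X)) (fun Q => I Q / ν Q) x} ≤
      I {x | t < mx (F : Set (Set X)) (fun Q => I Q / ν Q) x} := by
  classical
  rw [mx_level]
  refine weak _ (hL.mono (Finset.coe_subset.2 (Finset.filter_subset _ _)))
    (fun Q hQ => hm Q (Finset.mem_filter.1 hQ).1) t fun Q hQ => ?_
  have h := Finset.mem_filter.1 hQ
  exact (ENNReal.le_div_iff_mul_le (Or.inl (h0 Q h.1)) (Or.inl (hfin Q h.1))).1 h.2.le

theorem doob {ν : Measure X} (F : Finset (Set X)) (hL : Lam (F : Set (Set X)))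
    (hm : ∀ Q ∈ F, MeasurableSet Q) (h0 : ∀ Q ∈ F, ν Q ≠ 0) (hfin : ∀ Q ∈ F, ν Q ≠ ∞)
    {φ : X → ℝ≥0∞} (hφ : Measurable φ) {u : ℝ} (hu : 1 < u) :
    ∫⁻ x, mx (F : Set (Set X)) (fun Q => ν.withDensity φ Q / ν Q) x ^ u ∂ν ≤
      ENNReal.ofReal (u / (u - 1)) ^ u * ∫⁻ x, φ x ^ u ∂ν := by
  have hu0 : 0 < u := by linarith
  have hu1 : 0 < u - 1 := by linarith
  set c := ENNReal.ofReal (u / (u - 1)) with hc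
  have hcpos : 0 < u / (u - 1) := by positivity
  have hc0 : c ≠ 0 := by simp [hc, hcpos]
  have hct : c ≠ ∞ := by simp [hc]
  by_cases hT : ∫⁻ x, φ x ^ u ∂ν = ∞
  · rw [hT, ENNReal.mul_top]
    · exact le_top
    · exact (ENNReal.rpow_pos (pos_iff_ne_zero.2 hc0) hct).ne'
  set I := ν.withDensity φ with hI
  set M := mx (F : Set (Set X)) (fun Q => I Q / ν Q) with hM
  have hb : ∀ Q ∈ F, I Q / ν Q ≠ ∞ := by
    intro Q hQ
    refine ENNReal.div_ne_top ?_ (h0 Q hQ)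
    rw [hI, withDensity_apply _ (hm Q hQ)]
    have : ∫⁻ x in Q, φ x ∂ν ≤ ∫⁻ x in Q, (1 + φ x ^ u) ∂ν := by
      refine lintegral_mono fun x => ?_
      rcases le_total (φ x) 1 with h | h
      · exact h.trans le_self_add
      · calc φ x = φ x ^ (1:ℝ) := by simp
          _ ≤ φ x ^ u := ENNReal.rpow_le_rpow_of_exponent_le h hu.le
          _ ≤ _ := le_add_self
    refine ne_top_of_le_ne_top ?_ this
    rw [lintegral_add_left measurable_const]
    simp only [lintegral_const, Measure.restrict_apply MeasurableSet.univ, Set.univ_inter, one_mul]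
    refine ENNReal.add_ne_top.2 ⟨hfin Q hQ, ne_top_of_le_ne_top hT ?_⟩
    exact setLIntegral_le_lintegral _ _
  have hMf : ∀ x, M x ≠ ∞ := mx_ne_top F hb
  have hMm : Measurable M := measurable_mx F.countable_toSet hm _
  have hfinite : ∫⁻ x, M x ^ u ∂ν ≠ ∞ := by
    have hb2 : ∀ x, M x ^ u ≤ ∑ Q ∈ F, Q.indicator (fun _ => (∑ R ∈ F, I R / ν R) ^ u) x := by
      intro x
      by_cases hx : ∃ Q ∈ F, x ∈ Q
      · obtain ⟨Q, hQ, hxQ⟩ := hx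
        calc M x ^ u ≤ (∑ R ∈ F, I R / ν R) ^ u := by
              refine ENNReal.rpow_le_rpow (mx_le fun Q hQ _ => ?_) hu0.le
              exact Finset.single_le_sum (f := fun Q => I Q / ν Q) (fun _ _ => zero_le) hQ
          _ = Q.indicator (fun _ => (∑ R ∈ F, I R / ν R) ^ u) x := by simp [hxQ]
          _ ≤ _ := Finset.single_le_sum
            (f := fun Q : Set X => Q.indicator (fun _ => (∑ R ∈ F, I R / ν R) ^ u) x)
            (fun _ _ => zero_le) hQ
      · have : M x = 0 := le_antisymm (mx_le fun Q hQ hxQ => absurd ⟨Q, hQ, hxQ⟩ hx) zero_le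
        rw [this, ENNReal.zero_rpow_of_pos hu0]; exact zero_le
    refine ne_top_of_le_ne_top ?_ (lintegral_mono hb2)
    rw [lintegral_finsetSum _ fun Q hQ => measurable_const.indicator (hm Q hQ)]
    refine ENNReal.sum_ne_top.2 fun Q hQ => ?_
    rw [lintegral_indicator_const (hm Q hQ)]
    refine ENNReal.mul_ne_top (ENNReal.rpow_ne_top_of_nonneg hu0.le (ENNReal.sum_ne_top.2 hb)) (hfin Q hQ)
  have hstep : ∫⁻ x, M x ^ u ∂ν ≤ c * ∫⁻ x, M x ^ (u - 1) ∂I := by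
    rw [layercake ν hMm hMf hu0, layercake I hMm hMf hu1, ← mul_assoc, hc,
      ← ENNReal.ofReal_mul hcpos.le, div_mul_cancel₀ _ hu1.ne']
    gcongr ENNReal.ofReal u * ?_
    refine setLIntegral_mono' measurableSet_Ioi fun t ht => ?_
    have ht' : (0:ℝ) < t := ht
    have h1 : ENNReal.ofReal (t ^ (u - 1)) = ENNReal.ofReal t * ENNReal.ofReal (t ^ (u - 1 - 1)) := by
      rw [← ENNReal.ofReal_mul ht'.le]
      congr 1
      rw [← Real.rpow_one_add' ht'.le]
      · ring_nf
      · linarith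
    rw [h1, ← mul_assoc, mul_comm (ν _)]
    gcongr
    exact mx_weak F hL hm h0 hfin _
  have hI2 : ∫⁻ x, M x ^ (u - 1) ∂I = ∫⁻ x, φ x * M x ^ (u - 1) ∂ν := by
    rw [hI, lintegral_withDensity_eq_lintegral_mul _ hφ (hMm.pow_const _)]
    rfl
  have hconj : u.HolderConjugate (u / (u - 1)) := Real.HolderConjugate.conjExponent hu
  have hH := ENNReal.lintegral_mul_le_Lp_mul_Lq ν hconj hφ.aemeasurable
    (hMm.pow_const (u - 1)).aemeasurable
  have hH2 : ∫⁻ x, M x ^ (u - 1) ∂I ≤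
      (∫⁻ x, φ x ^ u ∂ν) ^ (1 / u) * (∫⁻ x, M x ^ u ∂ν) ^ (1 - 1 / u) := by
    rw [hI2]
    refine hH.trans_eq ?_
    congr 2
    · refine lintegral_congr fun x => ?_
      rw [← ENNReal.rpow_mul, mul_div_cancel₀ _ hu1.ne']
    · field_simp
  set Y := ∫⁻ x, M x ^ u ∂ν with hY
  by_cases hY0 : Y = 0
  · rw [hY0]; exact zero_le
  have h3 : Y ≤ (c * (∫⁻ x, φ x ^ u ∂ν) ^ (1 / u)) * Y ^ (1 - 1 / u) := by
    rw [mul_assoc]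
    exact hstep.trans (by gcongr)
  have h4 : Y ^ (1 / u) ≤ c * (∫⁻ x, φ x ^ u ∂ν) ^ (1 / u) := by
    have h5 : Y = Y ^ (1 / u) * Y ^ (1 - 1 / u) := by
      rw [← ENNReal.rpow_add _ _ hY0 hfinite]; simp
    rw [h5] at h3
    have hz : Y ^ (1 - 1 / u) ≠ 0 := (ENNReal.rpow_pos (pos_iff_ne_zero.2 hY0) hfinite).ne'
    have hzt : Y ^ (1 - 1 / u) ≠ ∞ := ENNReal.rpow_ne_top_of_ne_zero hY0 hfinite
    rw [← h5] at h3
    have h6 : Y ^ (1 / u) * Y ^ (1 - 1 / u) ≤ (c * (∫⁻ x, φ x ^ u ∂ν) ^ (1 / u)) * Y ^ (1 - 1 / u) := by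
      rw [← h5]; exact h3
    exact (ENNReal.mul_le_mul_iff_left hz hzt).1 h6
  have h7 := ENNReal.rpow_le_rpow h4 hu0.le
  rw [← ENNReal.rpow_mul, ENNReal.mul_rpow_of_nonneg _ _ hu0.le, ← ENNReal.rpow_mul] at h7
  simpa [hu0.ne'] using h7

theorem kolm {μ ν : Measure X} (F : Finset (Set X)) (hL : Lam (F : Set (Set X)))
    (hm : ∀ Q ∈ F, MeasurableSet Q) (h0 : ∀ Q ∈ F, ν Q ≠ 0) (hfin : ∀ Q ∈ F, ν Q ≠ ∞)
    (S : Set X) (hS : ∀ Q ∈ F, Q ⊆ S) (hμ0 : μ S ≠ 0) (hμt : μ S ≠ ∞)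
    (hν0 : ν S ≠ 0) (hνt : ν S ≠ ∞) {κ : ℝ} (hκ0 : 0 ≤ κ) (hκ : κ < 1) :
    ∫⁻ x in S, mx (F : Set (Set X)) (fun Q => μ Q / ν Q) x ^ κ ∂ν ≤
      ENNReal.ofReal (1 / (1 - κ)) * (ν S ^ (1 - κ) * μ S ^ κ) := by
  rcases hκ0.eq_or_lt with rfl | hκpos
  · simp
  set h := mx (F : Set (Set X)) (fun Q => μ Q / ν Q) with hh
  have hμQ : ∀ Q ∈ F, μ Q ≠ ∞ := fun Q hQ => ne_top_of_le_ne_top hμt (measure_mono (hS Q hQ))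
  have hhm : Measurable h := measurable_mx F.countable_toSet hm _
  have hhf : ∀ x, h x ≠ ∞ := mx_ne_top F fun Q hQ => ENNReal.div_ne_top (hμQ Q hQ) (h0 Q hQ)
  set a := (ν S).toReal with ha
  set b := (μ S).toReal with hb
  have hapos : 0 < a := ENNReal.toReal_pos hν0 hνt
  have hbpos : 0 < b := ENNReal.toReal_pos hμ0 hμt
  have haS : ν S = ENNReal.ofReal a := (ENNReal.ofReal_toReal hνt).symm
  have hbS : μ S = ENNReal.ofReal b := (ENNReal.ofReal_toReal hμt).symm
  set l := b / a with hl
  have hlpos : 0 < l := by positivity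
  rw [layercake (ν.restrict S) hhm hhf hκpos]
  have hsplit : Set.Ioi (0:ℝ) = Set.Ioc 0 l ∪ Set.Ioi l := (Set.Ioc_union_Ioi_eq_Ioi hlpos.le).symm
  have hmeas : ∀ t : ℝ, MeasurableSet {x | ENNReal.ofReal t < h x} := fun t =>
    measurableSet_lt measurable_const hhm
  have hb1 : ∫⁻ t in Set.Ioc 0 l, (ν.restrict S) {x | ENNReal.ofReal t < h x} *
      ENNReal.ofReal (t ^ (κ - 1)) ≤ ENNReal.ofReal (a * (l ^ κ / κ)) := by
    calc _ ≤ ∫⁻ t in Set.Ioc 0 l, ENNReal.ofReal a * ENNReal.ofReal (t ^ (κ - 1)) := by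
          refine lintegral_mono fun t => ?_
          gcongr
          rw [Measure.restrict_apply (hmeas t), ← haS]
          exact measure_mono Set.inter_subset_right
      _ = ENNReal.ofReal a * ∫⁻ t in Set.Ioc 0 l, ENNReal.ofReal (t ^ (κ - 1)) :=
          lintegral_const_mul' _ _ ENNReal.ofReal_ne_top
      _ = _ := by
          have hInt0 : IntervalIntegrable (fun t : ℝ => t ^ (κ - 1)) volume 0 l :=
            intervalIntegral.intervalIntegrable_rpow' (by linarith)
          rw [← ofReal_integral_eq_lintegral_ofReal
            ((intervalIntegrable_iff_integrableOn_Ioc_of_le hlpos.le).1 hInt0),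
            ← intervalIntegral.integral_of_le hlpos.le, integral_rpow (Or.inl (by linarith)),
            ← ENNReal.ofReal_mul hapos.le]
          · congr 1
            rw [show κ - 1 + 1 = κ by ring, Real.zero_rpow hκpos.ne', sub_zero]
          · refine (ae_restrict_mem measurableSet_Ioc).mono fun t ht => ?_
            exact Real.rpow_nonneg ht.1.le _
  have hb2 : ∫⁻ t in Set.Ioi l, (ν.restrict S) {x | ENNReal.ofReal t < h x} *
      ENNReal.ofReal (t ^ (κ - 1)) ≤ ENNReal.ofReal (b * (l ^ (κ - 1) / (1 - κ))) := by
    calc _ ≤ ∫⁻ t in Set.Ioi l, ENNReal.ofReal b * ENNReal.ofReal (t ^ (κ - 2)) := by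
          refine setLIntegral_mono' measurableSet_Ioi fun t ht => ?_
          have ht' : 0 < t := hlpos.trans ht
          have h1 : ENNReal.ofReal (t ^ (κ - 1)) = ENNReal.ofReal t * ENNReal.ofReal (t ^ (κ - 2)) := by
            rw [← ENNReal.ofReal_mul ht'.le]
            congr 1
            rw [← Real.rpow_one_add' ht'.le]
            · ring_nf
            · linarith
          rw [h1, ← mul_assoc, mul_comm (Measure.restrict ν S _)]
          gcongr
          rw [Measure.restrict_apply (hmeas t), ← hbS]
          have hw := mx_weak (ν := ν) (I := μ) F hL hm h0 hfin (ENNReal.ofReal t)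
          refine le_trans (by gcongr; exact Set.inter_subset_left) (hw.trans (measure_mono ?_))
          intro x hx
          obtain ⟨Q, hQ, hxQ, _⟩ := lt_mx.1 hx
          exact hS Q hQ hxQ
      _ = ENNReal.ofReal b * ∫⁻ t in Set.Ioi l, ENNReal.ofReal (t ^ (κ - 2)) :=
          lintegral_const_mul' _ _ ENNReal.ofReal_ne_top
      _ = _ := by
          rw [← ofReal_integral_eq_lintegral_ofReal
            (integrableOn_Ioi_rpow_of_lt (by linarith) hlpos),
            integral_Ioi_rpow_of_lt (by linarith) hlpos, ← ENNReal.ofReal_mul hbpos.le]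
          · congr 2
            rw [show κ - 2 + 1 = κ - 1 by ring, neg_div, ← div_neg]
            congr 1; ring
          · refine (ae_restrict_mem measurableSet_Ioi).mono fun t ht => ?_
            exact Real.rpow_nonneg (hlpos.trans ht).le _
  calc _ ≤ ENNReal.ofReal κ * (ENNReal.ofReal (a * (l ^ κ / κ)) +
        ENNReal.ofReal (b * (l ^ (κ - 1) / (1 - κ)))) := by
        gcongr
        rw [hsplit]
        exact (lintegral_union_le _ _ _).trans (add_le_add hb1 hb2)
    _ = ENNReal.ofReal (1 / (1 - κ) * (a ^ (1 - κ) * b ^ κ)) := by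
        have h1κ : 0 < 1 - κ := by linarith
        rw [← ENNReal.ofReal_add (by positivity) (by positivity), ← ENNReal.ofReal_mul hκpos.le]
        congr 1
        have e1 : a * l ^ κ = a ^ (1 - κ) * b ^ κ := by
          rw [hl, Real.div_rpow hbpos.le hapos.le, Real.rpow_sub hapos, Real.rpow_one]
          field_simp
        have e2 : b * l ^ (κ - 1) = a ^ (1 - κ) * b ^ κ := by
          rw [← e1, Real.rpow_sub hlpos, Real.rpow_one, hl]
          field_simp
        have e3 : a * (l ^ κ / κ) = a ^ (1 - κ) * b ^ κ / κ := by rw [← e1]; ring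
        have e4 : b * (l ^ (κ - 1) / (1 - κ)) = a ^ (1 - κ) * b ^ κ / (1 - κ) := by rw [← e2]; ring
        rw [e3, e4]
        field_simp
        ring
    _ = _ := by
        have h1κ : 0 < 1 - κ := by linarith
        rw [haS, hbS, ENNReal.ofReal_rpow_of_pos hapos, ENNReal.ofReal_rpow_of_pos hbpos,
          ENNReal.ofReal_mul (by positivity), ENNReal.ofReal_mul (by positivity)]

/-- passing from finite to countable families -/
theorem mx_mct {ν : Measure X} {D : Set (Set X)} (hD : D.Countable) (hm : ∀ Q ∈ D, MeasurableSet Q)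
    (a : Set X → ℝ≥0∞) {p : ℝ} (hp : 0 < p) (B : ℝ≥0∞)
    (h : ∀ F : Finset (Set X), (F : Set (Set X)) ⊆ D → ∫⁻ x, mx (F : Set (Set X)) a x ^ p ∂ν ≤ B) :
    ∫⁻ x, mx D a x ^ p ∂ν ≤ B := by
  classical
  rcases D.eq_empty_or_nonempty with rfl | hne
  · simpa using h ∅ (by simp)
  obtain ⟨e, he⟩ := hD.exists_eq_range hne
  let F : ℕ → Finset (Set X) := fun n => (Finset.range n).image e
  have hFD : ∀ n, (F n : Set (Set X)) ⊆ D := by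
    intro n Q hQ
    simp only [F, Finset.coe_image, Set.mem_image] at hQ
    obtain ⟨i, _, rfl⟩ := hQ
    rw [he]; exact Set.mem_range_self i
  have hmono : Monotone fun n x => mx (F n : Set (Set X)) a x ^ p := by
    intro n k hnk x
    refine ENNReal.rpow_le_rpow (mx_mono a ?_ x) hp.le
    exact Finset.coe_subset.2 (Finset.image_subset_image (Finset.range_mono hnk))
  have hle : ∀ x, mx D a x ^ p ≤ ⨆ n, mx (F n : Set (Set X)) a x ^ p := by
    intro x
    have : mx D a x ≤ (⨆ n, mx (F n : Set (Set X)) a x ^ p) ^ (1 / p) := by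
      refine mx_le fun Q hQ hx => ?_
      rw [he] at hQ
      obtain ⟨i, rfl⟩ := hQ
      rw [← ENNReal.rpow_le_rpow_iff hp, ← ENNReal.rpow_mul, one_div_mul_cancel hp.ne', ENNReal.rpow_one]
      refine le_iSup_of_le (i + 1) (ENNReal.rpow_le_rpow (le_mx a ?_ hx) hp.le)
      exact Finset.mem_coe.2 (Finset.mem_image_of_mem e (Finset.self_mem_range_succ i))
    calc mx D a x ^ p ≤ _ := ENNReal.rpow_le_rpow this hp.le
      _ = _ := by rw [← ENNReal.rpow_mul, one_div_mul_cancel hp.ne', ENNReal.rpow_one]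
  calc _ ≤ ∫⁻ x, ⨆ n, mx (F n : Set (Set X)) a x ^ p ∂ν := lintegral_mono hle
    _ = ⨆ n, ∫⁻ x, mx (F n : Set (Set X)) a x ^ p ∂ν :=
      lintegral_iSup (fun n => (measurable_mx (F n).countable_toSet
        (fun Q hQ => hm Q (hFD n hQ)) a).pow_const p) hmono
    _ ≤ B := iSup_le fun n => h (F n) (hFD n)

end S7

namespace S7

theorem rpow_anti {x y : ℝ≥0∞} {z : ℝ} (hz : z ≤ 0) (h : x ≤ y) : y ^ z ≤ x ^ z := by
  have hx : x ^ z = (x ^ (-z))⁻¹ := by rw [ENNReal.rpow_neg, inv_inv]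
  have hy : y ^ z = (y ^ (-z))⁻¹ := by rw [ENNReal.rpow_neg, inv_inv]
  rw [hx, hy]
  exact ENNReal.inv_le_inv.2 (ENNReal.rpow_le_rpow h (by linarith))

theorem le_rpow_one_div_iff' {x y : ℝ≥0∞} {q : ℝ} (hq : 0 < q) : x ≤ y ^ (1 / q) ↔ x ^ q ≤ y := by
  rw [one_div]; exact ENNReal.le_rpow_inv_iff hq

theorem rpow_one_div_le_iff' {x y : ℝ≥0∞} {q : ℝ} (hq : 0 < q) : x ^ (1 / q) ≤ y ↔ x ≤ y ^ q := by
  rw [one_div]; exact ENNReal.rpow_inv_le_iff hq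

theorem sum_holder {σ ι : Type*} [Fintype ι] (S : Finset σ) (Y : ι → σ → ℝ≥0∞) (t : ι → ℝ)
    (ht : ∀ j, 0 ≤ t j) (hs : ∑ j, t j = 1) :
    ∑ x ∈ S, ∏ j, Y j x ^ t j ≤ ∏ j, (∑ x ∈ S, Y j x) ^ t j := by
  letI : MeasurableSpace S := ⊤
  have h := ENNReal.lintegral_prod_norm_pow_le (μ := (Measure.count : Measure S)) (Finset.univ : Finset ι)
    (f := fun j x => Y j x) (fun j _ => (measurable_from_top).aemeasurable) (p := t) hs (fun j _ => ht j)
  simp only [lintegral_count, tsum_fintype] at h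
  rw [← Finset.sum_coe_sort S]
  refine h.trans_eq ?_
  refine Finset.prod_congr rfl fun j _ => ?_
  rw [← Finset.sum_coe_sort S]

theorem prod_pow_mul {ι : Type*} [Fintype ι] (c : ℝ≥0∞) (hc : c ≠ 0) (hc' : c ≠ ∞)
    (t : ι → ℝ) : ∏ j, c ^ t j = c ^ (∑ j, t j) := by
  classical
  induction (Finset.univ : Finset ι) using Finset.induction_on with
  | empty => simp
  | insert a s ha ih => rw [Finset.prod_insert ha, Finset.sum_insert ha, ih, ENNReal.rpow_add _ _ hc hc']

/-- the arithmetic heart of the sharp bound -/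
theorem arith {ι : Type*} [Fintype ι] (s ε : ι → ℝ≥0∞) (e P : ι → ℝ) (γ : ℝ) (K : ℝ≥0∞)
    (hs0 : ∀ j, s j ≠ 0) (hst : ∀ j, s j ≠ ∞) (hε0 : ∀ j, ε j ≠ 0) (hle : ∀ j, ε j ≤ s j)
    (hγ : ∀ j, e j ≤ γ * (e j - P j)) (hγ1 : 1 ≤ γ)
    (hK : ∏ j, s j ^ (e j - P j) ≤ K)
    (hE : (2 : ℝ≥0∞) ^ (- ∑ j, (e j - P j)) ≤ ∏ j, ε j ^ (e j - P j)) :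
    ∏ j, s j ^ e j ≤ 2 ^ ((∑ j, (e j - P j)) * (γ - 1)) * K ^ γ * ∏ j, ε j ^ P j := by
  have hεt : ∀ j, ε j ≠ ∞ := fun j => ne_top_of_le_ne_top (hst j) (hle j)
  have h1 : ∀ j, s j ^ e j ≤ (s j ^ (e j - P j)) ^ γ * (ε j ^ P j * (ε j ^ (e j - P j)) ^ (1 - γ)) := by
    intro j
    have a1 : s j ^ e j = s j ^ (γ * (e j - P j)) * s j ^ (e j - γ * (e j - P j)) := by
      rw [← ENNReal.rpow_add _ _ (hs0 j) (hst j)]; congr 1; ring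
    have a2 : ε j ^ P j * (ε j ^ (e j - P j)) ^ (1 - γ) = ε j ^ (e j - γ * (e j - P j)) := by
      rw [← ENNReal.rpow_mul, ← ENNReal.rpow_add _ _ (hε0 j) (hεt j)]; congr 1; ring
    rw [a1, a2, ← ENNReal.rpow_mul, mul_comm (e j - P j) γ]
    exact mul_le_mul_right (rpow_anti (by linarith [hγ j]) (hle j)) _
  calc ∏ j, s j ^ e j ≤ ∏ j, (s j ^ (e j - P j)) ^ γ * (ε j ^ P j * (ε j ^ (e j - P j)) ^ (1 - γ)) :=
        Finset.prod_le_prod' fun j _ => h1 j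
    _ = (∏ j, s j ^ (e j - P j)) ^ γ * ((∏ j, ε j ^ P j) * (∏ j, ε j ^ (e j - P j)) ^ (1 - γ)) := by
        rw [Finset.prod_mul_distrib, Finset.prod_mul_distrib, ENNReal.prod_rpow_of_nonneg (by linarith),
          ENNReal.prod_rpow_of_ne_top]
        exact fun j _ => ENNReal.rpow_ne_top_of_ne_zero (hε0 j) (hεt j)
    _ ≤ K ^ γ * ((∏ j, ε j ^ P j) * ((2 : ℝ≥0∞) ^ (- ∑ j, (e j - P j))) ^ (1 - γ)) := by
        gcongr ?_ * (_ * ?_)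
        · exact ENNReal.rpow_le_rpow hK (by linarith)
        · exact rpow_anti (by linarith) hE
    _ = _ := by
        rw [← ENNReal.rpow_mul, show (- ∑ j, (e j - P j)) * (1 - γ) = (∑ j, (e j - P j)) * (γ - 1) by ring]
        ring

variable {X : Type*} [MeasurableSpace X]

/-- the constant for a single index -/
def cst (e P q : ℝ) : ℝ≥0∞ :=
  if P = 0 then 1 else (ENNReal.ofReal ((e / P) / (e / P - 1)) ^ (e / P)) ^ (P * q)

theorem single {ν : Measure X} (S F : Finset (Set X)) (hSF : S ⊆ F) (hL : Lam (F : Set (Set X)))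
    (hm : ∀ Q ∈ F, MeasurableSet Q) (h0 : ∀ Q ∈ F, ν Q ≠ 0) (hfin : ∀ Q ∈ F, ν Q ≠ ∞)
    {φ : X → ℝ≥0∞} (hφ : Measurable φ) (E : Set X → Set X)
    (hE : ∀ Q ∈ S, MeasurableSet (E Q) ∧ E Q ⊆ Q) (hd : (S : Set (Set X)).PairwiseDisjoint E)
    {e P q : ℝ} (hP : 0 ≤ P) (he : P < e) (hq : 0 < q) (N : ℝ≥0∞)
    (hN : (0 < P ∧ ∫⁻ x, φ x ^ (e / P) ∂ν ≤ N ^ (1 / P)) ∨ (P = 0 ∧ ∀ᵐ x ∂ν, φ x ≤ N ^ (1 / e))) :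
    ∃ (B : ℝ≥0∞) (Y : Set X → ℝ≥0∞),
      (∀ Q ∈ S, ((ν.withDensity φ Q / ν Q) ^ e * ν (E Q) ^ P) ^ q ≤ B * Y Q ^ (P * q)) ∧
      B * (∑ Q ∈ S, Y Q) ^ (P * q) ≤ cst e P q * N ^ q := by
  have he0 : 0 < e := by linarith
  rcases hN with ⟨hP', hN⟩ | ⟨hP', hN⟩
  · have hu : 1 < e / P := by rw [one_lt_div hP']; exact he
    refine ⟨1, fun Q => (ν.withDensity φ Q / ν Q) ^ (e / P) * ν (E Q), fun Q _ => ?_, ?_⟩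
    · rw [one_mul, ENNReal.rpow_mul, ENNReal.mul_rpow_of_nonneg _ _ hP, ← ENNReal.rpow_mul,
        div_mul_cancel₀ _ hP'.ne']
    · have hD := doob F hL hm h0 hfin hφ hu
      have h1 : ∑ Q ∈ S, (ν.withDensity φ Q / ν Q) ^ (e / P) * ν (E Q) ≤
          ENNReal.ofReal ((e / P) / (e / P - 1)) ^ (e / P) * N ^ (1 / P) := by
        refine le_trans ?_ (hD.trans (by gcongr))
        calc _ ≤ ∑ Q ∈ S, ∫⁻ x in E Q,
              mx (F : Set (Set X)) (fun Q => ν.withDensity φ Q / ν Q) x ^ (e / P) ∂ν := by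
              refine Finset.sum_le_sum fun Q hQ => ?_
              rw [← setLIntegral_const]
              refine setLIntegral_mono' (hE Q hQ).1 fun x hx => ?_
              exact ENNReal.rpow_le_rpow (le_mx (fun Q => ν.withDensity φ Q / ν Q) (hSF hQ)
                ((hE Q hQ).2 hx)) (by linarith)
          _ = ∫⁻ x in ⋃ Q ∈ S, E Q,
              mx (F : Set (Set X)) (fun Q => ν.withDensity φ Q / ν Q) x ^ (e / P) ∂ν :=
              (lintegral_biUnion_finset hd (fun Q hQ => (hE Q hQ).1) _).symm
          _ ≤ _ := setLIntegral_le_lintegral _ _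
      rw [one_mul]
      have hPq : 0 ≤ P * q := by positivity
      refine (ENNReal.rpow_le_rpow h1 hPq).trans_eq ?_
      rw [ENNReal.mul_rpow_of_nonneg _ _ hPq, cst, if_neg hP'.ne', ← ENNReal.rpow_mul N]
      congr 2
      field_simp
  · subst hP'
    refine ⟨N ^ q, fun _ => 1, fun Q hQ => ?_, by simp [cst]⟩
    simp only [ENNReal.rpow_zero, mul_one, zero_mul]
    refine ENNReal.rpow_le_rpow ?_ hq.le
    have hQF := hSF hQ
    have : ν.withDensity φ Q / ν Q ≤ N ^ (1 / e) := by
      refine ENNReal.div_le_of_le_mul ?_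
      rw [withDensity_apply _ (hm Q hQF), ← setLIntegral_const]
      exact lintegral_mono_ae (ae_restrict_of_ae hN)
    calc _ ≤ (N ^ (1 / e)) ^ e := ENNReal.rpow_le_rpow this he0.le
      _ = N := by rw [← ENNReal.rpow_mul, one_div_mul_cancel he0.ne', ENNReal.rpow_one]

/-- the constant of the maximal theorem -/
def cstA {ι : Type*} [Fintype ι] (e P : ι → ℝ) (q γ : ℝ) : ℝ≥0∞ :=
  Aconst e ^ q * (2 * (2 ^ ((∑ j, (e j - P j)) * (γ - 1))) ^ q * ∏ j, cst (e j) (P j) q)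

theorem thmA_fin {ι : Type*} [Fintype ι] {μ : Measure X} {ν : ι → Measure X} {φ : ι → X → ℝ≥0∞}
    (hφ : ∀ j, Measurable (φ j)) {e P : ι → ℝ} (hP : ∀ j, 0 ≤ P j) (he : ∀ j, P j < e j)
    {q : ℝ} (hq : 0 < q) (hPq : ∑ j, P j = 1 / q) {γ : ℝ} (hγ1 : 1 ≤ γ)
    (hγ : ∀ j, e j ≤ γ * (e j - P j))
    (F : Finset (Set X)) (hL : Lam (F : Set (Set X)))
    (hm : ∀ Q ∈ F, MeasurableSet Q) (hμ0 : ∀ Q ∈ F, μ Q ≠ 0) (hμt : ∀ Q ∈ F, μ Q ≠ ∞)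
    (hν0 : ∀ j, ∀ Q ∈ F, ν j Q ≠ 0) (hνt : ∀ j, ∀ Q ∈ F, ν j Q ≠ ∞)
    (hH : ∀ E, MeasurableSet E → μ E ^ (∑ j, (e j - P j)) ≤ ∏ j, ν j E ^ (e j - P j))
    (K : ℝ≥0∞) (hK : ∀ Q ∈ F, ∏ j, (ν j Q / μ Q) ^ (e j - P j) ≤ K)
    (N : ι → ℝ≥0∞)
    (hN : ∀ j, (0 < P j ∧ ∫⁻ x, φ j x ^ (e j / P j) ∂(ν j) ≤ N j ^ (1 / P j)) ∨
      (P j = 0 ∧ ∀ᵐ x ∂(ν j), φ j x ≤ N j ^ (1 / e j))) :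
    ∫⁻ x, mx (F : Set (Set X)) (pav μ (fun j => (ν j).withDensity (φ j)) e) x ^ q ∂μ ≤
      cstA e P q γ * (K ^ γ * ∏ j, N j) ^ q := by
  classical
  have he0 : ∀ j, 0 < e j := fun j => (hP j).trans_lt (he j)
  set a := pav μ (fun j => (ν j).withDensity (φ j)) e with ha
  set A := Aconst e with hA
  obtain ⟨S, hSF, E, h1, h2, h3⟩ := sparse (μ := μ) a A (Aconst_ge e he0) F hL hm hμt
    (fun S hS => pav_stop he0 F hL hm hμ0 hμt S hS)
  choose! B Y hY1 hY2 using fun j => single S F hSF hL hm (hν0 j) (hνt j) (hφ j) E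
    (fun Q hQ => ⟨(h2 Q hQ).1, (h2 Q hQ).2.1⟩) h3 (hP j) (he j) hq (N j) (hN j)
  set Δ := ∑ j, (e j - P j) with hΔ
  set C : ℝ≥0∞ := 2 ^ (Δ * (γ - 1)) with hC
  have htest : ∀ Q ∈ S, a Q ^ q * μ Q ≤ C ^ q * (K ^ γ) ^ q *
      ∏ j, (((ν j).withDensity (φ j) Q / ν j Q) ^ e j * ν j (E Q) ^ P j) ^ q := by
    intro Q hQ
    have hQF := hSF hQ
    have hμE : μ (E Q) ≠ 0 := by
      intro h
      have := (h2 Q hQ).2.2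
      rw [h, mul_zero] at this
      exact hμ0 Q hQF (le_antisymm this zero_le)
    have hδ : ∀ j, 0 < e j - P j := fun j => by linarith [he j]
    have hΔ0 : 0 ≤ Δ := Finset.sum_nonneg fun j _ => (hδ j).le
    have hνE : ∀ j, ν j (E Q) ≠ 0 := by
      intro j h
      have h4 := hH (E Q) (h2 Q hQ).1
      rw [Finset.prod_eq_zero (Finset.mem_univ j)] at h4
      · have : μ (E Q) ^ Δ ≠ 0 := (ENNReal.rpow_pos (pos_iff_ne_zero.2 hμE)
          (ne_top_of_le_ne_top (hμt Q hQF) (measure_mono (h2 Q hQ).2.1))).ne'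
        exact this (le_antisymm h4 zero_le)
      · rw [h, ENNReal.zero_rpow_of_pos (hδ j)]
    have hd1 : ∀ x : ℝ≥0∞, x ≠ 0 → x / μ Q ≠ 0 := fun x hx => by
      simp [ENNReal.div_eq_zero_iff, hx, hμt Q hQF]
    have har := arith (fun j => ν j Q / μ Q) (fun j => ν j (E Q) / μ Q) e P γ K
      (fun j => hd1 _ (hν0 j Q hQF)) (fun j => ENNReal.div_ne_top (hνt j Q hQF) (hμ0 Q hQF))
      (fun j => hd1 _ (hνE j)) (fun j => ENNReal.div_le_div_right (measure_mono (h2 Q hQ).2.1) _)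
      hγ hγ1 (hK Q hQF) (by
        have hdiv : ∀ j, (ν j (E Q) / μ Q) ^ (e j - P j) =
            ν j (E Q) ^ (e j - P j) * (μ Q)⁻¹ ^ (e j - P j) := fun j => by
          rw [div_eq_mul_inv, ENNReal.mul_rpow_of_nonneg _ _ (hδ j).le]
        simp only [hdiv]
        rw [Finset.prod_mul_distrib, prod_pow_mul (μ Q)⁻¹ (ENNReal.inv_ne_zero.2 (hμt Q hQF))
          (ENNReal.inv_ne_top.2 (hμ0 Q hQF))]
        refine le_trans ?_ (mul_le_mul_left (hH (E Q) (h2 Q hQ).1) _)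
        rw [← ENNReal.mul_rpow_of_nonneg _ _ hΔ0, ENNReal.rpow_neg, ← ENNReal.inv_rpow]
        refine ENNReal.rpow_le_rpow ?_ hΔ0
        rw [ENNReal.inv_le_iff_inv_le, ENNReal.mul_inv (Or.inl hμE) (Or.inr (ENNReal.inv_ne_zero.2 (hμt Q hQF))),
          inv_inv]
        have := (h2 Q hQ).2.2
        calc (μ (E Q))⁻¹ * μ Q ≤ (μ (E Q))⁻¹ * (2 * μ (E Q)) := by gcongr
          _ = 2 * ((μ (E Q))⁻¹ * μ (E Q)) := by ring
          _ ≤ 2 * 1 := by gcongr; exact ENNReal.inv_mul_le_one _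
          _ = 2 := mul_one _)
    have haQ : a Q = (∏ j, ((ν j).withDensity (φ j) Q / ν j Q) ^ e j) * ∏ j, (ν j Q / μ Q) ^ e j := by
      rw [ha, pav, ← Finset.prod_mul_distrib]
      refine Finset.prod_congr rfl fun j _ => ?_
      rw [← ENNReal.mul_rpow_of_nonneg _ _ (he0 j).le]
      congr 1
      rw [div_eq_mul_inv, div_eq_mul_inv, div_eq_mul_inv]
      calc _ = (ν j).withDensity (φ j) Q * ((ν j Q)⁻¹ * ν j Q) * (μ Q)⁻¹ := by
            rw [ENNReal.inv_mul_cancel (hν0 j Q hQF) (hνt j Q hQF), mul_one]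
        _ = _ := by ring
    have hprodP : ∏ j, (ν j (E Q) / μ Q) ^ P j = (∏ j, ν j (E Q) ^ P j) * (μ Q)⁻¹ ^ (1 / q) := by
      have hdiv : ∀ j, (ν j (E Q) / μ Q) ^ P j = ν j (E Q) ^ P j * (μ Q)⁻¹ ^ P j := fun j => by
          rw [div_eq_mul_inv, ENNReal.mul_rpow_of_nonneg _ _ (hP j)]
      simp only [hdiv]
      rw [Finset.prod_mul_distrib, prod_pow_mul (μ Q)⁻¹ (ENNReal.inv_ne_zero.2 (hμt Q hQF))
          (ENNReal.inv_ne_top.2 (hμ0 Q hQF)), hPq]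
    have haQ2 : a Q ≤ (C * K ^ γ * ∏ j, (((ν j).withDensity (φ j) Q / ν j Q) ^ e j * ν j (E Q) ^ P j)) *
        (μ Q)⁻¹ ^ (1 / q) := by
      rw [haQ]
      refine (mul_le_mul_right har _).trans_eq ?_
      simp only [hprodP]
      rw [Finset.prod_mul_distrib]
      ring
    calc a Q ^ q * μ Q ≤ ((C * K ^ γ * ∏ j, (((ν j).withDensity (φ j) Q / ν j Q) ^ e j * ν j (E Q) ^ P j)) *
        (μ Q)⁻¹ ^ (1 / q)) ^ q * μ Q := by gcongr
      _ = _ := by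
        rw [ENNReal.mul_rpow_of_nonneg _ _ hq.le, ENNReal.mul_rpow_of_nonneg _ _ hq.le,
          ENNReal.mul_rpow_of_nonneg _ _ hq.le, ← ENNReal.rpow_mul (μ Q)⁻¹, one_div_mul_cancel hq.ne',
          ENNReal.rpow_one, mul_assoc, ENNReal.inv_mul_cancel (hμ0 Q hQF) (hμt Q hQF), mul_one,
          ENNReal.prod_rpow_of_nonneg hq.le]
  have hsumH : ∑ Q ∈ S, ∏ j, (((ν j).withDensity (φ j) Q / ν j Q) ^ e j * ν j (E Q) ^ P j) ^ q ≤
      (∏ j, cst (e j) (P j) q) * (∏ j, N j) ^ q := by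
    calc _ ≤ ∑ Q ∈ S, ∏ j, (B j * Y j Q ^ (P j * q)) :=
          Finset.sum_le_sum fun Q hQ => Finset.prod_le_prod' fun j _ => hY1 j Q hQ
      _ = (∏ j, B j) * ∑ Q ∈ S, ∏ j, Y j Q ^ (P j * q) := by
          rw [Finset.mul_sum]; simp only [Finset.prod_mul_distrib]
      _ ≤ (∏ j, B j) * ∏ j, (∑ Q ∈ S, Y j Q) ^ (P j * q) := by
          gcongr
          refine sum_holder S Y (fun j => P j * q) (fun j => mul_nonneg (hP j) hq.le) ?_
          rw [← Finset.sum_mul, hPq, one_div_mul_cancel hq.ne']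
      _ = ∏ j, (B j * (∑ Q ∈ S, Y j Q) ^ (P j * q)) := by rw [Finset.prod_mul_distrib]
      _ ≤ ∏ j, (cst (e j) (P j) q * N j ^ q) := Finset.prod_le_prod' fun j _ => hY2 j
      _ = _ := by rw [Finset.prod_mul_distrib, ENNReal.prod_rpow_of_nonneg hq.le]
  have hpt : ∀ x, mx (F : Set (Set X)) a x ^ q ≤
      ∑ Q ∈ S, Q.indicator (fun _ => A ^ q * a Q ^ q) x := by
    intro x
    have : mx (F : Set (Set X)) a x ≤ (∑ Q ∈ S, Q.indicator (fun _ => A ^ q * a Q ^ q) x) ^ (1 / q) := by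
      refine mx_le fun Q hQ hx => ?_
      obtain ⟨R, hR, hQR, haR⟩ := h1 Q hQ
      rw [le_rpow_one_div_iff' hq]
      calc a Q ^ q ≤ (A * a R) ^ q := by gcongr
        _ = R.indicator (fun _ => A ^ q * a R ^ q) x := by
          simp [hQR hx, ENNReal.mul_rpow_of_nonneg _ _ hq.le]
        _ ≤ _ := Finset.single_le_sum (f := fun R : Set X => R.indicator (fun _ => A ^ q * a R ^ q) x)
          (fun _ _ => zero_le) hR
    exact (le_rpow_one_div_iff' hq).1 this
  calc _ ≤ ∫⁻ x, ∑ Q ∈ S, Q.indicator (fun _ => A ^ q * a Q ^ q) x ∂μ := lintegral_mono hpt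
    _ = ∑ Q ∈ S, A ^ q * a Q ^ q * μ Q := by
        rw [lintegral_finsetSum _ fun Q hQ => measurable_const.indicator (hm Q (hSF hQ))]
        exact Finset.sum_congr rfl fun Q hQ => lintegral_indicator_const (hm Q (hSF hQ)) _
    _ = A ^ q * ∑ Q ∈ S, a Q ^ q * μ Q := by
        rw [Finset.mul_sum]; simp only [mul_assoc]
    _ ≤ A ^ q * ∑ Q ∈ S, C ^ q * (K ^ γ) ^ q *
      ∏ j, (((ν j).withDensity (φ j) Q / ν j Q) ^ e j * ν j (E Q) ^ P j) ^ q := by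
        exact mul_le_mul_right (Finset.sum_le_sum htest) _
    _ = A ^ q * (C ^ q * (K ^ γ) ^ q * ∑ Q ∈ S,
      ∏ j, (((ν j).withDensity (φ j) Q / ν j Q) ^ e j * ν j (E Q) ^ P j) ^ q) := by
        congr 1; rw [Finset.mul_sum]
    _ ≤ A ^ q * (C ^ q * (K ^ γ) ^ q * ((∏ j, cst (e j) (P j) q) * (∏ j, N j) ^ q)) := by gcongr
    _ = A ^ q * (1 * C ^ q * ∏ j, cst (e j) (P j) q) * ((K ^ γ) ^ q * (∏ j, N j) ^ q) := by ring
    _ ≤ A ^ q * (2 * C ^ q * ∏ j, cst (e j) (P j) q) * ((K ^ γ) ^ q * (∏ j, N j) ^ q) := by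
        gcongr; norm_num
    _ = _ := by rw [cstA, ENNReal.mul_rpow_of_nonneg _ _ hq.le]

theorem thmA {ι : Type*} [Fintype ι] {μ : Measure X} {ν : ι → Measure X} {φ : ι → X → ℝ≥0∞}
    (hφ : ∀ j, Measurable (φ j)) {e P : ι → ℝ} (hP : ∀ j, 0 ≤ P j) (he : ∀ j, P j < e j)
    {q : ℝ} (hq : 0 < q) (hPq : ∑ j, P j = 1 / q) {γ : ℝ} (hγ1 : 1 ≤ γ)
    (hγ : ∀ j, e j ≤ γ * (e j - P j))
    {D : Set (Set X)} (hD : D.Countable) (hL : Lam D)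
    (hm : ∀ Q ∈ D, MeasurableSet Q) (hμ0 : ∀ Q ∈ D, μ Q ≠ 0) (hμt : ∀ Q ∈ D, μ Q ≠ ∞)
    (hν0 : ∀ j, ∀ Q ∈ D, ν j Q ≠ 0) (hνt : ∀ j, ∀ Q ∈ D, ν j Q ≠ ∞)
    (hH : ∀ E, MeasurableSet E → μ E ^ (∑ j, (e j - P j)) ≤ ∏ j, ν j E ^ (e j - P j))
    (K : ℝ≥0∞) (hK : ∀ Q ∈ D, ∏ j, (ν j Q / μ Q) ^ (e j - P j) ≤ K)
    (N : ι → ℝ≥0∞)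
    (hN : ∀ j, (0 < P j ∧ ∫⁻ x, φ j x ^ (e j / P j) ∂(ν j) ≤ N j ^ (1 / P j)) ∨
      (P j = 0 ∧ ∀ᵐ x ∂(ν j), φ j x ≤ N j ^ (1 / e j))) :
    ∫⁻ x, mx D (pav μ (fun j => (ν j).withDensity (φ j)) e) x ^ q ∂μ ≤
      cstA e P q γ * (K ^ γ * ∏ j, N j) ^ q :=
  mx_mct hD hm _ hq _ fun F hF => thmA_fin hφ hP he hq hPq hγ1 hγ F (hL.mono hF)
    (fun Q hQ => hm Q (hF hQ)) (fun Q hQ => hμ0 Q (hF hQ)) (fun Q hQ => hμt Q (hF hQ))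
    (fun j Q hQ => hν0 j Q (hF hQ)) (fun j Q hQ => hνt j Q (hF hQ)) hH K
    (fun Q hQ => hK Q (hF hQ)) N hN

theorem cst_ne_top {e P q : ℝ} (hP : 0 ≤ P) (he : P < e) (hq : 0 < q) : cst e P q ≠ ∞ := by
  unfold cst
  split_ifs with h
  · simp
  · have : 0 < e / P := div_pos (by linarith) (lt_of_le_of_ne hP (Ne.symm h))
    exact ENNReal.rpow_ne_top_of_nonneg (by positivity)
      (ENNReal.rpow_ne_top_of_nonneg this.le ENNReal.ofReal_ne_top)

theorem cstA_ne_top {ι : Type*} [Fintype ι] {e P : ι → ℝ} (hP : ∀ j, 0 ≤ P j) (he : ∀ j, P j < e j)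
    {q : ℝ} (hq : 0 < q) {γ : ℝ} : cstA e P q γ ≠ ∞ := by
  unfold cstA
  refine ENNReal.mul_ne_top (ENNReal.rpow_ne_top_of_nonneg hq.le
    (Aconst_ne e fun j => (hP j).trans_lt (he j))) (ENNReal.mul_ne_top (ENNReal.mul_ne_top (by simp) ?_) ?_)
  · exact ENNReal.rpow_ne_top_of_nonneg hq.le (ENNReal.rpow_ne_top_of_ne_zero (by simp) (by simp))
  · exact ENNReal.prod_ne_top fun j _ => cst_ne_top (hP j) (he j) hq

end S7

namespace S7
variable {X : Type*} [MeasurableSpace X]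

theorem lower_fin {ι : Type*} [Fintype ι] {μ ν : Measure X} {I : ι → Measure X} {e : ι → ℝ}
    (he : ∀ j, 0 < e j) {p S : ℝ} (hp : 0 < p) (hS : 0 ≤ S) (hpS : p * S < 1)
    (F : Finset (Set X)) (hL : Lam (F : Set (Set X)))
    (hm : ∀ Q ∈ F, MeasurableSet Q) (hμ0 : ∀ Q ∈ F, μ Q ≠ 0) (hμt : ∀ Q ∈ F, μ Q ≠ ∞)
    (hν0 : ∀ Q ∈ F, ν Q ≠ 0) (hνt : ∀ Q ∈ F, ν Q ≠ ∞) :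
    ∫⁻ x, mx (F : Set (Set X)) (fun Q => pav μ I e Q * (μ Q / ν Q) ^ S) x ^ p ∂ν ≤
      Aconst e ^ p * (ENNReal.ofReal (1 / (1 - p * S)) * 2) *
        ∫⁻ x, mx (F : Set (Set X)) (fun Q => pav μ I e Q * (ν Q / μ Q) ^ (1 / p - S)) x ^ p ∂μ := by
  classical
  set a := pav μ I e with ha
  set A := Aconst e with hA
  set κ := p * S with hκ
  have hκ0 : 0 ≤ κ := by positivity
  obtain ⟨T, hTF, E, h1, h2, h3⟩ := sparse (μ := μ) a A (Aconst_ge e he) F hL hm hμt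
    (fun S hS => pav_stop he F hL hm hμ0 hμt S hS)
  let G : Set X → Finset (Set X) := fun R => F.filter fun Q => Q ⊆ R
  have hGF : ∀ R, G R ⊆ F := fun R => Finset.filter_subset _ _
  set M : Set X → X → ℝ≥0∞ := fun R => mx (G R : Set (Set X)) (fun Q => μ Q / ν Q) with hM
  have hMm : ∀ R, Measurable (M R) := fun R =>
    measurable_mx (G R).countable_toSet (fun Q hQ => hm Q (hGF R hQ)) _
  have hpt : ∀ x, mx (F : Set (Set X)) (fun Q => a Q * (μ Q / ν Q) ^ S) x ^ p ≤
      ∑ R ∈ T, R.indicator (fun x => A ^ p * a R ^ p * M R x ^ κ) x := by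
    intro x
    refine (le_rpow_one_div_iff' hp).1 (mx_le fun Q hQ hx => (le_rpow_one_div_iff' hp).2 ?_)
    obtain ⟨R, hR, hQR, haR⟩ := h1 Q hQ
    calc (a Q * (μ Q / ν Q) ^ S) ^ p = a Q ^ p * (μ Q / ν Q) ^ κ := by
          rw [ENNReal.mul_rpow_of_nonneg _ _ hp.le, ← ENNReal.rpow_mul, hκ, mul_comm S]
      _ ≤ (A * a R) ^ p * M R x ^ κ := by
          refine mul_le_mul' (ENNReal.rpow_le_rpow haR hp.le) (ENNReal.rpow_le_rpow ?_ hκ0)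
          exact le_mx (D := (G R : Set (Set X))) (fun Q => μ Q / ν Q)
            (Finset.mem_coe.2 (Finset.mem_filter.2 ⟨hQ, hQR⟩)) hx
      _ = R.indicator (fun x => A ^ p * a R ^ p * M R x ^ κ) x := by
          simp [hQR hx, ENNReal.mul_rpow_of_nonneg _ _ hp.le]
      _ ≤ _ := Finset.single_le_sum
          (f := fun R : Set X => R.indicator (fun x => A ^ p * a R ^ p * M R x ^ κ) x)
          (fun _ _ => zero_le) hR
  set c := ENNReal.ofReal (1 / (1 - κ)) with hc
  set N := mx (F : Set (Set X)) (fun Q => a Q * (ν Q / μ Q) ^ (1 / p - S)) with hN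
  have hterm : ∀ R ∈ T, A ^ p * a R ^ p * ∫⁻ x in R, M R x ^ κ ∂ν ≤
      A ^ p * (c * 2) * ∫⁻ x in E R, N x ^ p ∂μ := by
    intro R hR
    have hRF := hTF hR
    have hk := kolm (μ := μ) (ν := ν) (G R) (hL.mono (by exact_mod_cast hGF R)) (fun Q hQ => hm Q (hGF R hQ))
      (fun Q hQ => hν0 Q (hGF R hQ)) (fun Q hQ => hνt Q (hGF R hQ)) R
      (fun Q hQ => (Finset.mem_filter.1 hQ).2) (hμ0 R hRF) (hμt R hRF) (hν0 R hRF) (hνt R hRF) hκ0 hpS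
    have hid : ν R ^ (1 - κ) * μ R ^ κ = (ν R / μ R) ^ (1 - κ) * μ R := by
      rw [div_eq_mul_inv, ENNReal.mul_rpow_of_nonneg _ _ (by linarith), mul_assoc]
      congr 1
      nth_rw 3 [← ENNReal.rpow_one (μ R)]
      rw [← ENNReal.rpow_neg_one, ← ENNReal.rpow_mul, ← ENNReal.rpow_add _ _ (hμ0 R hRF) (hμt R hRF)]
      congr 1; ring
    calc A ^ p * a R ^ p * ∫⁻ x in R, M R x ^ κ ∂ν
        ≤ A ^ p * a R ^ p * (c * ((ν R / μ R) ^ (1 - κ) * (2 * μ (E R)))) := by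
          refine mul_le_mul_right (hk.trans ?_) _
          rw [hid]
          exact mul_le_mul_right (mul_le_mul_right (h2 R hR).2.2 _) _
      _ = A ^ p * (c * 2) * ((a R * (ν R / μ R) ^ (1 / p - S)) ^ p * μ (E R)) := by
          rw [ENNReal.mul_rpow_of_nonneg _ _ hp.le, ← ENNReal.rpow_mul,
            show (1 / p - S) * p = 1 - κ by rw [hκ]; field_simp]
          ring
      _ ≤ _ := by
          refine mul_le_mul_right ?_ _
          rw [← setLIntegral_const]
          refine setLIntegral_mono' (h2 R hR).1 fun x hx => ENNReal.rpow_le_rpow ?_ hp.le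
          exact le_mx (fun Q => a Q * (ν Q / μ Q) ^ (1 / p - S)) hRF ((h2 R hR).2.1 hx)
  calc _ ≤ ∫⁻ x, ∑ R ∈ T, R.indicator (fun x => A ^ p * a R ^ p * M R x ^ κ) x ∂ν := lintegral_mono hpt
    _ = ∑ R ∈ T, A ^ p * a R ^ p * ∫⁻ x in R, M R x ^ κ ∂ν := by
        rw [lintegral_finsetSum _ fun R hR =>
          (((hMm R).pow_const _).const_mul _).indicator (hm R (hTF hR))]
        refine Finset.sum_congr rfl fun R hR => ?_
        rw [lintegral_indicator (hm R (hTF hR)), lintegral_const_mul _ ((hMm R).pow_const _)]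
    _ ≤ ∑ R ∈ T, A ^ p * (c * 2) * ∫⁻ x in E R, N x ^ p ∂μ := Finset.sum_le_sum hterm
    _ = A ^ p * (c * 2) * ∫⁻ x in ⋃ R ∈ T, E R, N x ^ p ∂μ := by
        rw [← Finset.mul_sum, lintegral_biUnion_finset h3 (fun Q hQ => (h2 Q hQ).1)]
    _ ≤ _ := mul_le_mul_right (setLIntegral_le_lintegral _ _) _

theorem lower {ι : Type*} [Fintype ι] {μ ν : Measure X} {I : ι → Measure X} {e : ι → ℝ}
    (he : ∀ j, 0 < e j) {p S : ℝ} (hp : 0 < p) (hS : 0 ≤ S) (hpS : p * S < 1)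
    {D : Set (Set X)} (hD : D.Countable) (hL : Lam D)
    (hm : ∀ Q ∈ D, MeasurableSet Q) (hμ0 : ∀ Q ∈ D, μ Q ≠ 0) (hμt : ∀ Q ∈ D, μ Q ≠ ∞)
    (hν0 : ∀ Q ∈ D, ν Q ≠ 0) (hνt : ∀ Q ∈ D, ν Q ≠ ∞) :
    ∫⁻ x, mx D (fun Q => pav μ I e Q * (μ Q / ν Q) ^ S) x ^ p ∂ν ≤
      Aconst e ^ p * (ENNReal.ofReal (1 / (1 - p * S)) * 2) *
        ∫⁻ x, mx D (fun Q => pav μ I e Q * (ν Q / μ Q) ^ (1 / p - S)) x ^ p ∂μ := by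
  refine mx_mct hD hm _ hp _ fun F hF => ?_
  refine (lower_fin he hp hS hpS F (hL.mono hF)
    (fun Q hQ => hm Q (hF hQ)) (fun Q hQ => hμ0 Q (hF hQ)) (fun Q hQ => hμt Q (hF hQ))
    (fun Q hQ => hν0 Q (hF hQ)) (fun Q hQ => hνt Q (hF hQ))).trans ?_
  refine mul_le_mul_right (lintegral_mono fun x => ?_) _
  exact ENNReal.rpow_le_rpow (mx_mono _ hF x) hp.le

end S7

namespace S7

def bsh (b : Bool) : ℤ := if b then 1 else 0

/-- index of the shifted dyadic interval of generation `k` containing `t` -/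
def lev (b : Bool) (k : ℤ) (t : ℝ) : ℤ := ⌊(2:ℝ) ^ k * t + (-1:ℝ) ^ k * (bsh b / 3)⌋

theorem lev_succ (b : Bool) (k : ℤ) {s t : ℝ} (h : lev b (k + 1) s = lev b (k + 1) t) :
    lev b k s = lev b k t := by
  obtain ⟨z, hz⟩ : ∃ z : ℤ, (-1 : ℝ) ^ k = z := by
    rcases Int.even_or_odd k with h | h
    · exact ⟨1, by simp [h.neg_one_zpow]⟩
    · exact ⟨-1, by simp [h.neg_one_zpow]⟩
  have key : ∀ u : ℝ, lev b k u = (lev b (k + 1) u + z * bsh b) / 2 := by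
    intro u
    unfold lev
    have : (2:ℝ) ^ k * u + (-1:ℝ) ^ k * (bsh b / 3) =
        ((2:ℝ) ^ (k + 1) * u + (-1:ℝ) ^ (k + 1) * (bsh b / 3) + ((z * bsh b : ℤ) : ℝ)) / (2 : ℕ) := by
      rw [zpow_add₀ (by norm_num), zpow_add₀ (by norm_num), ← hz.symm]
      push_cast
      rw [← hz]
      simp only [zpow_one]; push_cast
      ring
    rw [this, Int.floor_div_natCast, Int.floor_add_intCast]
    rfl
  rw [key, key, h]

theorem lev_le (b : Bool) {k l : ℤ} (hkl : k ≤ l) {s t : ℝ} (h : lev b l s = lev b l t) :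
    lev b k s = lev b k t := by
  obtain ⟨n, rfl⟩ := Int.le.dest hkl
  induction n with
  | zero => simpa using h
  | succ n ih =>
    refine ih (by omega) (lev_succ b _ ?_)
    rw [show k + (n : ℤ) + 1 = k + ((n + 1 : ℕ) : ℤ) by push_cast; ring]
    exact h

variable {d : ℕ}

def gcube (α : Fin d → Bool) (k : ℤ) (n : Fin d → ℤ) : Cube d where
  corner i := (2:ℝ) ^ (-k) * (n i - (-1:ℝ) ^ k * (bsh (α i) / 3))
  side := (2:ℝ) ^ (-k)
  side_pos := by positivity

theorem mem_gcube (α : Fin d → Bool) (k : ℤ) (n : Fin d → ℤ) (x : Fin d → ℝ) :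
    x ∈ (gcube α k n).set ↔ ∀ i, lev (α i) k (x i) = n i := by
  unfold Cube.set gcube lev
  simp only [Set.mem_ofPred_eq]
  refine forall_congr' fun i => ?_
  have h2 : (0:ℝ) < (2:ℝ) ^ k := by positivity
  rw [Int.floor_eq_iff, zpow_neg]
  set c := (-1:ℝ) ^ k * (bsh (α i) / 3)
  constructor
  · rintro ⟨h, h'⟩
    rw [inv_mul_le_iff₀ h2] at h
    have : x i < ((2:ℝ) ^ k)⁻¹ * (n i - c + 1) := by linarith
    rw [lt_inv_mul_iff₀ h2] at this
    constructor <;> linarith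
  · rintro ⟨h, h'⟩
    constructor
    · rw [inv_mul_le_iff₀ h2]; linarith
    · have : x i < ((2:ℝ) ^ k)⁻¹ * (n i - c + 1) := by
        rw [lt_inv_mul_iff₀ h2]; linarith
      linarith

/-- the shifted dyadic grids -/
def grid (α : Fin d → Bool) : Set (Set (Fin d → ℝ)) :=
  Set.range fun kn : ℤ × (Fin d → ℤ) => (gcube α kn.1 kn.2).set

theorem grid_countable (α : Fin d → Bool) : (grid α).Countable := Set.countable_range _

theorem grid_lam (α : Fin d → Bool) : Lam (grid α) := by
  have key : ∀ k l : ℤ, k ≤ l → ∀ n n' : Fin d → ℤ, (gcube α l n').set ⊆ (gcube α k n).set ∨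
      Disjoint (gcube α k n).set (gcube α l n').set := by
    intro k l hkl n n'
    by_cases hd : Disjoint (gcube α k n).set (gcube α l n').set
    · exact Or.inr hd
    · left
      obtain ⟨x, hx, hx'⟩ := Set.not_disjoint_iff.1 hd
      intro y hy
      rw [mem_gcube] at hx hx' hy ⊢
      intro i
      rw [← hx i]
      exact lev_le _ hkl ((hy i).trans (hx' i).symm)
  rintro _ ⟨⟨k, n⟩, rfl⟩ _ ⟨⟨l, n'⟩, rfl⟩
  rcases le_total k l with h | h
  · rcases key k l h n n' with h | h
    · exact Or.inr (Or.inl h)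
    · exact Or.inr (Or.inr h)
  · rcases key l k h n' n with h | h
    · exact Or.inl h
    · exact Or.inr (Or.inr h.symm)

theorem cube_pi (Q : Cube d) :
    Q.set = Set.pi Set.univ fun i => Set.Ico (Q.corner i) (Q.corner i + Q.side) := by
  ext x; simp [Cube.set]

theorem cube_meas (Q : Cube d) : MeasurableSet Q.set := by
  rw [cube_pi]; exact MeasurableSet.univ_pi fun i => measurableSet_Ico

theorem cube_vol (Q : Cube d) : volume Q.set = ENNReal.ofReal Q.side ^ d := by
  rw [cube_pi, volume_pi_pi]
  simp

theorem cube_vol_ne_zero (Q : Cube d) : volume Q.set ≠ 0 := by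
  rw [cube_vol]; exact pow_ne_zero _ (by simpa using Q.side_pos)

theorem cube_vol_ne_top (Q : Cube d) : volume Q.set ≠ ∞ := by
  rw [cube_vol]; exact ENNReal.pow_ne_top ENNReal.ofReal_ne_top

theorem grid_cube {α : Fin d → Bool} {R : Set (Fin d → ℝ)} (h : R ∈ grid α) :
    ∃ Q : Cube d, Q.set = R := by
  obtain ⟨⟨k, n⟩, rfl⟩ := h
  exact ⟨_, rfl⟩

theorem cover1 (k : ℤ) {c l : ℝ} (hl : 3 * l ≤ (2:ℝ) ^ (-k)) :
    ∃ b : Bool, ∃ n : ℤ, ∀ t, c ≤ t → t < c + l → lev b k t = n := by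
  have h2 : (0:ℝ) < (2:ℝ) ^ k := by positivity
  have hl' : (2:ℝ) ^ k * l ≤ 1 / 3 := by
    rw [zpow_neg] at hl
    have := mul_le_mul_of_nonneg_left hl h2.le
    rw [mul_inv_cancel₀ h2.ne'] at this
    linarith
  by_cases h : ∀ t, c ≤ t → t < c + l → lev false k t = lev false k c
  · exact ⟨false, _, h⟩
  push Not at h
  obtain ⟨x, hx1, hx2, hx⟩ := h
  simp only [lev, bsh] at hx
  norm_num at hx
  have a1 : (2:ℝ) ^ k * c ≤ 2 ^ k * x := by gcongr
  have a2 : (2:ℝ) ^ k * x < 2 ^ k * c + 1 / 3 := by nlinarith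
  have a3 : ⌊(2:ℝ) ^ k * c⌋ < ⌊(2:ℝ) ^ k * x⌋ := lt_of_le_of_ne (Int.floor_mono a1) (Ne.symm hx)
  set N := ⌊(2:ℝ) ^ k * x⌋ with hN
  have a4 : (2:ℝ) ^ k * c < N := Int.floor_lt.1 a3
  have a5 : (N:ℝ) ≤ 2 ^ k * x := Int.floor_le _
  have key : ∀ t, c ≤ t → t < c + l → (2:ℝ) ^ k * c ≤ 2 ^ k * t ∧ (2:ℝ) ^ k * t < 2 ^ k * c + 1 / 3 := by
    intro t h1 h2'
    exact ⟨by gcongr, by nlinarith⟩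
  rcases Int.even_or_odd k with he | ho
  · refine ⟨true, N, fun t h1 h2' => ?_⟩
    obtain ⟨b1, b2⟩ := key t h1 h2'
    simp only [lev, bsh, he.neg_one_zpow]
    rw [Int.floor_eq_iff]
    norm_num
    constructor <;> linarith
  · refine ⟨true, N - 1, fun t h1 h2' => ?_⟩
    obtain ⟨b1, b2⟩ := key t h1 h2'
    simp only [lev, bsh, ho.neg_one_zpow]
    rw [Int.floor_eq_iff]
    norm_num
    constructor <;> linarith

theorem cover (Q : Cube d) : ∃ α : Fin d → Bool, ∃ R ∈ grid α, Q.set ⊆ R ∧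
    volume R ≤ 6 ^ d * volume Q.set := by
  have hl := Q.side_pos
  obtain ⟨k, hk1, hk2⟩ := exists_mem_Ico_zpow (x := 1 / (3 * Q.side)) (y := (2:ℝ)) (by positivity) (by norm_num)
  have h2 : (0:ℝ) < (2:ℝ) ^ k := by positivity
  have h1 : 3 * Q.side ≤ (2:ℝ) ^ (-k) := by
    rw [zpow_neg, le_inv_comm₀ (by positivity) h2]
    simpa using hk1
  have h3 : (2:ℝ) ^ (-k) ≤ 6 * Q.side := by
    rw [zpow_add₀ (by norm_num), zpow_one, div_lt_iff₀ (by positivity)] at hk2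
    rw [zpow_neg, inv_le_iff_one_le_mul₀ h2]
    nlinarith
  choose b n hbn using fun i => cover1 k (c := Q.corner i) (l := Q.side) h1
  refine ⟨b, _, ⟨(k, n), rfl⟩, fun x hx => ?_, ?_⟩
  · rw [mem_gcube]
    exact fun i => hbn i _ (hx i).1 (hx i).2
  · rw [cube_vol, cube_vol, ← mul_pow]
    gcongr
    change ENNReal.ofReal ((2:ℝ) ^ (-k)) ≤ _
    rw [show (6 : ℝ≥0∞) = ENNReal.ofReal 6 by simp, ← ENNReal.ofReal_mul (by norm_num)]
    exact ENNReal.ofReal_le_ofReal h3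

end S7

namespace S7
variable {X : Type*} [MeasurableSpace X]

theorem wd_ne_zero {μ : Measure X} {σ : X → ℝ≥0∞} (hσ : Measurable σ) (h0 : ∀ x, σ x ≠ 0)
    {Q : Set X} (hQ : μ Q ≠ 0) : μ.withDensity σ Q ≠ 0 := fun h =>
  hQ (withDensity_absolutelyContinuous' hσ.aemeasurable (Filter.Eventually.of_forall h0) h)

theorem wd_wd {μ : Measure X} {σ f : X → ℝ≥0∞} (hσ : Measurable σ) (h0 : ∀ x, σ x ≠ 0)
    (ht : ∀ x, σ x ≠ ∞) (hf : Measurable f) :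
    (μ.withDensity σ).withDensity (fun x => f x * (σ x)⁻¹) = μ.withDensity f := by
  rw [← withDensity_mul μ hσ (show Measurable fun x => f x * (σ x)⁻¹ from hf.mul hσ.inv)]
  congr 1
  funext x
  simp only [Pi.mul_apply]
  rw [mul_comm, mul_assoc, ENNReal.inv_mul_cancel (h0 x) (ht x), mul_one]

theorem factor_ne_top {ι : Type*} [Fintype ι] (y : ι → ℝ≥0∞) (h0 : ∀ j, y j ≠ 0)
    (h : ∏ j, y j ≠ ∞) (j : ι) : y j ≠ ∞ := by
  classical
  intro hj
  apply h
  rw [← Finset.mul_prod_erase _ _ (Finset.mem_univ j), hj, ENNReal.top_mul]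
  exact Finset.prod_ne_zero_iff.2 fun i _ => h0 i

theorem holderH {ι : Type*} [Fintype ι] {μ : Measure X} {σ : ι → X → ℝ≥0∞} (hσ : ∀ j, Measurable (σ j))
    {δ : ι → ℝ} (hδ : ∀ j, 0 < δ j) [Nonempty ι] (h1 : ∀ x, ∏ j, σ j x ^ δ j = 1) (E : Set X)
    (hE : MeasurableSet E) :
    μ E ^ (∑ j, δ j) ≤ ∏ j, μ.withDensity (σ j) E ^ δ j := by
  set Δ := ∑ j, δ j with hΔ
  have hΔ0 : 0 < Δ := Finset.sum_pos (fun j _ => hδ j) Finset.univ_nonempty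
  have h := ENNReal.lintegral_prod_norm_pow_le (μ := μ.restrict E) (Finset.univ : Finset ι)
    (f := σ) (fun j _ => (hσ j).aemeasurable) (p := fun j => δ j / Δ)
    (by rw [← Finset.sum_div, ← hΔ, div_self hΔ0.ne']) (fun j _ => (div_pos (hδ j) hΔ0).le)
  have h2 : ∀ x, ∏ j, σ j x ^ (δ j / Δ) = 1 := by
    intro x
    have : ∀ j, σ j x ^ (δ j / Δ) = (σ j x ^ δ j) ^ (1 / Δ) := fun j => by
      rw [← ENNReal.rpow_mul]; congr 1; ring
    simp only [this]
    rw [ENNReal.prod_rpow_of_nonneg (by positivity), h1, ENNReal.one_rpow]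
  simp only [h2, lintegral_one, Measure.restrict_apply_univ] at h
  calc μ E ^ Δ ≤ (∏ j, (∫⁻ x in E, σ j x ∂μ) ^ (δ j / Δ)) ^ Δ := ENNReal.rpow_le_rpow h hΔ0.le
    _ = _ := by
      rw [← ENNReal.prod_rpow_of_nonneg hΔ0.le]
      refine Finset.prod_congr rfl fun j _ => ?_
      rw [← ENNReal.rpow_mul, div_mul_cancel₀ _ hΔ0.ne', withDensity_apply _ hE]

/-- integral condition translation -/
theorem norm_cond {μ : Measure X} {F ω : X → ℝ≥0∞} (hF : Measurable F) (hω : Measurable ω)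
    (hω0 : ∀ x, ω x ≠ 0) (hωt : ∀ x, ω x ≠ ∞) {e P : ℝ} (hP : 0 ≤ P) (he : P < e) {N : ℝ≥0∞}
    (hN : (0 < P ∧ ∫⁻ x, (F x * ω x) ^ (1 / P) ∂μ ≤ N ^ (1 / P)) ∨
      (P = 0 ∧ ∀ᵐ x ∂μ, F x * ω x ≤ N)) :
    (0 < P ∧ ∫⁻ x, (F x ^ (1 / e) * (ω x ^ (-1 / (e - P)))⁻¹) ^ (e / P)
        ∂(μ.withDensity fun x => ω x ^ (-1 / (e - P))) ≤ N ^ (1 / P)) ∨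
      (P = 0 ∧ ∀ᵐ x ∂(μ.withDensity fun x => ω x ^ (-1 / (e - P))),
        F x ^ (1 / e) * (ω x ^ (-1 / (e - P)))⁻¹ ≤ N ^ (1 / e)) := by
  have he0 : 0 < e := by linarith
  have hd : 0 < e - P := by linarith
  rcases hN with ⟨h, hN⟩ | ⟨h, hN⟩
  · refine Or.inl ⟨h, le_of_eq_of_le ?_ hN⟩
    rw [lintegral_withDensity_eq_lintegral_mul _ (hω.pow_const _)
      (show Measurable fun x => (F x ^ (1 / e) * (ω x ^ (-1 / (e - P)))⁻¹) ^ (e / P) from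
        ((hF.pow_const _).mul (hω.pow_const _).inv).pow_const _)]
    refine lintegral_congr fun x => ?_
    simp only [Pi.mul_apply]
    rw [ENNReal.mul_rpow_of_nonneg _ _ (by positivity), ENNReal.mul_rpow_of_nonneg _ _ (by positivity),
      ← ENNReal.rpow_mul, ← ENNReal.rpow_neg, ← ENNReal.rpow_mul, mul_left_comm,
      ← ENNReal.rpow_add _ _ (hω0 x) (hωt x)]
    congr 2 <;> field_simp
    ring
  · subst h
    refine Or.inr ⟨rfl, (withDensity_absolutelyContinuous _ _).ae_le ?_⟩
    filter_upwards [hN] with x hx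
    rw [← ENNReal.rpow_neg, sub_zero, show -(-1 / e) = 1 / e by ring,
      ← ENNReal.mul_rpow_of_nonneg _ _ (by positivity)]
    exact ENNReal.rpow_le_rpow hx (by positivity)

/-- the maximal theorem with a distinguished extra index -/
theorem appA {m : ℕ} {μ : Measure X} {e P : Fin m → ℝ} (hP : ∀ j, 0 ≤ P j) (he : ∀ j, P j < e j)
    {θ e0 P0 q γ : ℝ} (hθ : 0 < θ) (hP0 : 0 ≤ P0) (h0 : e0 - P0 = θ) (hq : 0 < q)
    (hPq : P0 + ∑ j, P j = 1 / q) (hγ1 : 1 ≤ γ) (hγ : ∀ j, e j ≤ γ * (e j - P j))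
    (hγ0 : e0 ≤ γ * θ) {ω : Fin m → X → ℝ≥0∞} (hω : ∀ j, Measurable (ω j))
    (hω0 : ∀ j x, ω j x ≠ 0) (hωt : ∀ j x, ω j x ≠ ∞)
    {D : Set (Set X)} (hD : D.Countable) (hL : Lam D)
    (hm : ∀ Q ∈ D, MeasurableSet Q) (hμ0 : ∀ Q ∈ D, μ Q ≠ 0) (hμt : ∀ Q ∈ D, μ Q ≠ ∞)
    {K : ℝ≥0∞} (hKt : K ≠ ∞)
    (hK : ∀ Q ∈ D, (μ.withDensity (fun x => (∏ j, ω j x) ^ (1 / θ)) Q / μ Q) ^ θ *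
      ∏ j, (μ.withDensity (fun x => ω j x ^ (-1 / (e j - P j))) Q / μ Q) ^ (e j - P j) ≤ K)
    {F : Fin m → X → ℝ≥0∞} (hF : ∀ j, Measurable (F j)) {N : Fin m → ℝ≥0∞}
    (hN : ∀ j, (0 < P j ∧ ∫⁻ x, (F j x * ω j x) ^ (1 / P j) ∂μ ≤ N j ^ (1 / P j)) ∨
      (P j = 0 ∧ ∀ᵐ x ∂μ, F j x * ω j x ≤ N j))
    {φ : X → ℝ≥0∞} (hφ : Measurable φ) {N0 : ℝ≥0∞}
    (hN0 : (0 < P0 ∧ ∫⁻ x, φ x ^ (e0 / P0) ∂(μ.withDensity fun x => (∏ j, ω j x) ^ (1 / θ)) ≤ N0 ^ (1 / P0)) ∨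
      (P0 = 0 ∧ ∀ᵐ x ∂(μ.withDensity fun x => (∏ j, ω j x) ^ (1 / θ)), φ x ≤ N0 ^ (1 / e0))) :
    (∀ Q ∈ D, μ.withDensity (fun x => (∏ j, ω j x) ^ (1 / θ)) Q ≠ ∞) ∧
    ∫⁻ x, mx D (fun Q => pav μ (fun j => μ.withDensity fun x => F j x ^ (1 / e j)) e Q *
        ((μ.withDensity fun x => (∏ j, ω j x) ^ (1 / θ)).withDensity φ Q / μ Q) ^ e0) x ^ q ∂μ ≤
      cstA (fun o : Option (Fin m) => o.elim e0 e) (fun o => o.elim P0 P) q γ *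
        (K ^ γ * (N0 * ∏ j, N j)) ^ q := by
  set σ : Option (Fin m) → X → ℝ≥0∞ := fun o => o.elim (fun x => (∏ j, ω j x) ^ (1 / θ))
    (fun j x => ω j x ^ (-1 / (e j - P j))) with hσdef
  set e' : Option (Fin m) → ℝ := fun o => o.elim e0 e with he'
  set P' : Option (Fin m) → ℝ := fun o => o.elim P0 P with hP'
  have hWm : Measurable fun x => ∏ j, ω j x := Finset.measurable_fun_prod _ fun j _ => hω j
  have hW0 : ∀ x, ∏ j, ω j x ≠ 0 := fun x => Finset.prod_ne_zero_iff.2 fun j _ => hω0 j x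
  have hWt : ∀ x, ∏ j, ω j x ≠ ∞ := fun x => ENNReal.prod_ne_top fun j _ => hωt j x
  have hσm : ∀ o, Measurable (σ o) := by
    rintro (_ | j)
    · exact hWm.pow_const _
    · exact (hω j).pow_const _
  have hσ0 : ∀ o x, σ o x ≠ 0 := by
    rintro (_ | j) x
    · exact (ENNReal.rpow_pos (pos_iff_ne_zero.2 (hW0 x)) (hWt x)).ne'
    · exact (ENNReal.rpow_pos (pos_iff_ne_zero.2 (hω0 j x)) (hωt j x)).ne'
  have hσt : ∀ o x, σ o x ≠ ∞ := by
    rintro (_ | j) x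
    · exact ENNReal.rpow_ne_top_of_ne_zero (hW0 x) (hWt x)
    · exact ENNReal.rpow_ne_top_of_ne_zero (hω0 j x) (hωt j x)
  have hδ : ∀ o, 0 < e' o - P' o := by
    rintro (_ | j)
    · simp only [he', hP', Option.elim]; linarith
    · simp only [he', hP', Option.elim]; linarith [he j]
  have hν0 : ∀ o, ∀ Q ∈ D, μ.withDensity (σ o) Q ≠ 0 := fun o Q hQ =>
    wd_ne_zero (hσm o) (hσ0 o) (hμ0 Q hQ)
  have hK' : ∀ Q ∈ D, ∏ o, (μ.withDensity (σ o) Q / μ Q) ^ (e' o - P' o) ≤ K := by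
    intro Q hQ
    rw [Fintype.prod_option]
    simp only [hσdef, he', hP', Option.elim, h0]
    exact hK Q hQ
  have hνt : ∀ o, ∀ Q ∈ D, μ.withDensity (σ o) Q ≠ ∞ := by
    intro o Q hQ htop
    have hdiv0 : ∀ o, μ.withDensity (σ o) Q / μ Q ≠ 0 := fun o => by
      simp [ENNReal.div_eq_zero_iff, hν0 o Q hQ, hμt Q hQ]
    refine factor_ne_top (fun o => (μ.withDensity (σ o) Q / μ Q) ^ (e' o - P' o)) (fun o => ?_)
      (ne_top_of_le_ne_top hKt (hK' Q hQ)) o ?_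
    · intro h
      rw [ENNReal.rpow_eq_zero_iff] at h
      rcases h with h | h
      · exact hdiv0 o h.1
      · linarith [hδ o]
    · simp only [htop]
      rw [ENNReal.top_div_of_ne_top (hμt Q hQ), ENNReal.top_rpow_of_pos (hδ o)]
  refine ⟨fun Q hQ => hνt none Q hQ, ?_⟩
  have h1 : ∀ x, ∏ o, σ o x ^ (e' o - P' o) = 1 := by
    intro x
    rw [Fintype.prod_option]
    simp only [hσdef, he', hP', Option.elim, h0]
    rw [← ENNReal.rpow_mul, one_div_mul_cancel hθ.ne', ENNReal.rpow_one]
    rw [← Finset.prod_mul_distrib]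
    refine Finset.prod_eq_one fun j _ => ?_
    have : e j - P j ≠ 0 := by linarith [he j]
    rw [← ENNReal.rpow_mul, div_mul_cancel₀ _ this, ENNReal.rpow_neg_one,
      ENNReal.mul_inv_cancel (hω0 j x) (hωt j x)]
  set φ' : Option (Fin m) → X → ℝ≥0∞ := fun o => o.elim φ
    (fun j x => F j x ^ (1 / e j) * (σ (some j) x)⁻¹) with hφ'
  have key := thmA (μ := μ) (ν := fun o => μ.withDensity (σ o)) (φ := φ') (e := e') (P := P')
    (by rintro (_ | j)
        · exact hφ
        · exact ((hF j).pow_const _).mul (hσm (some j)).inv)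
    (by rintro (_ | j)
        · exact hP0
        · exact hP j)
    (fun o => by linarith [hδ o]) hq
    (by rw [Fintype.sum_option]; exact hPq) hγ1
    (by rintro (_ | j)
        · simp only [he', hP', Option.elim, h0]; exact hγ0
        · exact hγ j)
    hD hL hm hμ0 hμt hν0 hνt (holderH hσm hδ h1) K hK' (fun o => o.elim N0 N)
    (by rintro (_ | j)
        · exact hN0
        · exact norm_cond (hF j) (hω j) (hω0 j) (hωt j) (hP j) (he j) (hN j))
  rw [Fintype.prod_option] at key
  refine le_of_eq_of_le ?_ key
  congr! 4 with x
  funext Q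
  rw [pav, pav, Fintype.prod_option, mul_comm]
  congr 1
  refine Finset.prod_congr rfl fun j _ => ?_
  rw [← wd_wd (μ := μ) (hσm (some j)) (hσ0 _) (hσt _) ((hF j).pow_const _)]
  rfl

end S7

namespace S7
variable {X : Type*} [MeasurableSpace X]

/-- truncation -/
def trunc (B : ℕ → Set X) (G : X → ℝ≥0∞) (n : ℕ) : X → ℝ≥0∞ :=
  (B n).indicator fun x => min (G x) n

theorem trunc_meas {B : ℕ → Set X} (hB : ∀ n, MeasurableSet (B n)) {G : X → ℝ≥0∞} (hG : Measurable G)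
    (n : ℕ) : Measurable (trunc B G n) := (hG.min measurable_const).indicator (hB n)

theorem trunc_le (B : ℕ → Set X) (G : X → ℝ≥0∞) (n : ℕ) (x : X) : trunc B G n x ≤ G x := by
  unfold trunc
  by_cases hx : x ∈ B n <;> simp [hx]

theorem trunc_le_nat (B : ℕ → Set X) (G : X → ℝ≥0∞) (n : ℕ) (x : X) :
    trunc B G n x ≤ (B n).indicator (fun _ => (n : ℝ≥0∞)) x := by
  unfold trunc
  by_cases hx : x ∈ B n <;> simp [hx]

theorem trunc_mono {B : ℕ → Set X} (hB : Monotone B) (G : X → ℝ≥0∞) (x : X) :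
    Monotone fun n => trunc B G n x := by
  intro k n hkn
  unfold trunc
  by_cases hx : x ∈ B k
  · have : x ∈ B n := hB hkn hx
    simp only [hx, this, Set.indicator_of_mem]
    exact min_le_min le_rfl (by exact_mod_cast hkn)
  · simp [hx]

theorem trunc_sup {B : ℕ → Set X} (hB : Monotone B) (hU : ∀ x, ∃ n, x ∈ B n) (G : X → ℝ≥0∞) (x : X) :
    ⨆ n, trunc B G n x = G x := by
  refine le_antisymm (iSup_le fun n => trunc_le B G n x) (le_of_forall_lt fun c hc => ?_)
  obtain ⟨n, hn⟩ := hU x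
  obtain ⟨k, hk⟩ := ENNReal.exists_nat_gt (ne_top_of_lt hc)
  refine lt_iSup_iff.2 ⟨max n k, ?_⟩
  unfold trunc
  have : x ∈ B (max n k) := hB (le_max_left _ _) hn
  simp only [this, Set.indicator_of_mem, lt_min_iff]
  exact ⟨hc, hk.trans_le (by exact_mod_cast le_max_right n k)⟩

theorem trunc_lint {μ : Measure X} {B : ℕ → Set X} (hB : Monotone B) (hBm : ∀ n, MeasurableSet (B n))
    (hU : ∀ x, ∃ n, x ∈ B n) {G H : X → ℝ≥0∞} (hG : Measurable G) (hH : Measurable H) {p : ℝ} (hp : 0 < p)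
    {R : ℝ≥0∞} (h : ∀ n, ∫⁻ x, (H x * trunc B G n x) ^ p ∂μ ≤ R) :
    ∫⁻ x, (H x * G x) ^ p ∂μ ≤ R := by
  have hpt : ∀ x, (H x * G x) ^ p = ⨆ n, (H x * trunc B G n x) ^ p := by
    intro x
    have := (ENNReal.orderIsoRpow p hp).map_iSup fun n => H x * trunc B G n x
    simp only [ENNReal.orderIsoRpow_apply] at this
    rw [← this, ← ENNReal.mul_iSup, trunc_sup hB hU]
  simp only [hpt]
  rw [lintegral_iSup (f := fun n x => (H x * trunc B G n x) ^ p)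
    (fun n => (hH.mul (trunc_meas hBm hG n)).pow_const _)]
  · exact iSup_le h
  · intro k n hkn x
    exact ENNReal.rpow_le_rpow (mul_le_mul_right (trunc_mono hB G x hkn) _) hp.le

theorem coreHi {m : ℕ} {μ : Measure X} [SigmaFinite μ] {e P : Fin m → ℝ} (hP : ∀ j, 0 ≤ P j)
    (he : ∀ j, P j < e j) {A : Type*} [Fintype A] {q S p γ : ℝ} (hq : 0 < q) (hp : 0 < p)
    (hPp : ∑ j, P j = 1 / p) (hS : 0 ≤ S) (hSp : S < 1 / p) (hpq : q < p)
    (hγ1 : 1 ≤ γ) (hγ : ∀ j, e j ≤ γ * (e j - P j)) (hγ0 : 1 / q - S ≤ γ * (1 / p - S))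
    {ω : Fin m → X → ℝ≥0∞} (hω : ∀ j, Measurable (ω j))
    (hω0 : ∀ j x, ω j x ≠ 0) (hωt : ∀ j x, ω j x ≠ ∞)
    {D : A → Set (Set X)} (hD : ∀ α, (D α).Countable) (hL : ∀ α, Lam (D α))
    (hm : ∀ α, ∀ Q ∈ D α, MeasurableSet Q) (hμ0 : ∀ α, ∀ Q ∈ D α, μ Q ≠ 0)
    (hμt : ∀ α, ∀ Q ∈ D α, μ Q ≠ ∞)
    {K : ℝ≥0∞} (hKt : K ≠ ∞)
    (hK : ∀ α, ∀ Q ∈ D α, (μ.withDensity (fun x => (∏ j, ω j x) ^ (1 / (1 / p - S))) Q / μ Q) ^ (1 / p - S) *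
      ∏ j, (μ.withDensity (fun x => ω j x ^ (-1 / (e j - P j))) Q / μ Q) ^ (e j - P j) ≤ K)
    {F : Fin m → X → ℝ≥0∞} (hF : ∀ j, Measurable (F j)) {N : Fin m → ℝ≥0∞}
    (hN : ∀ j, (0 < P j ∧ ∫⁻ x, (F j x * ω j x) ^ (1 / P j) ∂μ ≤ N j ^ (1 / P j)) ∨
      (P j = 0 ∧ ∀ᵐ x ∂μ, F j x * ω j x ≤ N j))
    {h : X → ℝ≥0∞} (hh : Measurable h) {C : ℝ≥0∞}
    (hT : ∀ G : X → ℝ≥0∞, Measurable G → ∫⁻ x, (h x * G x) ^ q ∂μ ≤ C ^ q *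
      ∑ α, ∫⁻ x, mx (D α) (fun Q => pav μ (fun j => μ.withDensity fun x => F j x ^ (1 / e j)) e Q *
        (μ.withDensity (fun x => G x ^ (1 / (1 / q - S))) Q / μ Q) ^ (1 / q - S)) x ^ q ∂μ) :
    ∫⁻ x, (h x * ∏ j, ω j x) ^ p ∂μ ≤
      (C * ((Fintype.card A) * cstA (fun o : Option (Fin m) => o.elim (1 / q - S) e)
        (fun o => o.elim (1 / q - 1 / p) P) q γ) ^ (1 / q) * (K ^ γ * ∏ j, N j)) ^ p := by
  set W : X → ℝ≥0∞ := fun x => ∏ j, ω j x with hW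
  have hWm : Measurable W := Finset.measurable_fun_prod _ fun j _ => hω j
  have hW0 : ∀ x, W x ≠ 0 := fun x => Finset.prod_ne_zero_iff.2 fun j _ => hω0 j x
  have hWt : ∀ x, W x ≠ ∞ := fun x => ENNReal.prod_ne_top fun j _ => hωt j x
  have hθ : 0 < 1 / p - S := by linarith
  have hP0 : 0 < 1 / q - 1 / p := by
    have := one_div_lt_one_div_of_lt hq hpq
    linarith
  have hϑ : 0 < 1 / q - S := by linarith
  set P0 := 1 / q - 1 / p with hP0d
  set ϑ := 1 / q - S with hϑd
  set θ := 1 / p - S with hθd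
  set c := cstA (fun o : Option (Fin m) => o.elim ϑ e) (fun o => o.elim P0 P) q γ with hc
  set Z := K ^ γ * ∏ j, N j with hZ
  set u := p / q - 1 with hu
  have hu0 : 0 < u := by rw [hu, sub_pos, one_lt_div hq]; exact hpq
  have huP : u * (1 / P0) = p := by
    have : q * p * P0 = p - q := by rw [hP0d]; field_simp
    have h1 : u * q = p - q := by rw [hu]; field_simp
    rw [mul_one_div, div_eq_iff hP0.ne']
    have : q * (p * P0) = q * u := by linarith
    exact (mul_left_cancel₀ hq.ne' this).symm
  have hU : ∀ x, ∃ n, x ∈ spanningSets μ n := fun x => by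
    have := iUnion_spanningSets μ
    exact Set.mem_iUnion.1 (this ▸ Set.mem_univ x)
  have key : ∀ n, ∫⁻ x, (1 * trunc (spanningSets μ) (fun x => h x * W x) n x) ^ p ∂μ ≤
      (C * (Fintype.card A * c) ^ (1 / q) * Z) ^ p := by
    intro n
    simp only [one_mul]
    set U := trunc (spanningSets μ) (fun x => h x * W x) n with hUdef
    have hUm : Measurable U := trunc_meas (measurableSet_spanningSets μ) (hh.mul hWm) n
    set Y := ∫⁻ x, U x ^ p ∂μ with hY
    have hYt : Y ≠ ∞ := by
      refine ne_top_of_le_ne_top ?_ (lintegral_mono (g := (spanningSets μ n).indicator fun _ => (n : ℝ≥0∞) ^ p)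
        fun x => ?_)
      · rw [lintegral_indicator_const (measurableSet_spanningSets μ n)]
        exact ENNReal.mul_ne_top (ENNReal.rpow_ne_top_of_nonneg hp.le (by simp))
          (measure_spanningSets_lt_top μ n).ne
      · have := ENNReal.rpow_le_rpow (trunc_le_nat (spanningSets μ) (fun x => h x * W x) n x) hp.le
        refine this.trans_eq ?_
        by_cases hx : x ∈ spanningSets μ n
        · simp [hx]
        · simp [hx, hp]
    by_cases hY0 : Y = 0
    · rw [hY0]; exact zero_le
    set G : X → ℝ≥0∞ := fun x => W x * U x ^ u with hG
    have hGm : Measurable G := hWm.mul (hUm.pow_const _)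
    have hσ : ∀ x, (W x)⁻¹ ^ (-1 / (ϑ - P0)) = W x ^ (1 / θ) := by
      intro x
      rw [← ENNReal.rpow_neg_one, ← ENNReal.rpow_mul]
      congr 1
      rw [show ϑ - P0 = θ by rw [hϑd, hP0d, hθd]; ring]; ring
    have hN0 := norm_cond (μ := μ) (N := Y ^ P0) hGm hWm.inv (fun x => ENNReal.inv_ne_zero.2 (hWt x))
      (fun x => ENNReal.inv_ne_top.2 (hW0 x)) hP0.le (by linarith : P0 < ϑ) (Or.inl ⟨hP0, by
        rw [← ENNReal.rpow_mul, mul_one_div_cancel hP0.ne', ENNReal.rpow_one]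
        refine le_of_eq (lintegral_congr fun x => ?_)
        have : G x * (W⁻¹) x = U x ^ u := by
          simp only [hG, Pi.inv_apply]
          rw [mul_comm, ← mul_assoc, ENNReal.inv_mul_cancel (hW0 x) (hWt x), one_mul]
        rw [this, ← ENNReal.rpow_mul, huP]⟩)
    simp only [Pi.inv_apply, hσ] at hN0
    have hA : ∀ α, ∫⁻ x, mx (D α) (fun Q => pav μ (fun j => μ.withDensity fun x => F j x ^ (1 / e j)) e Q *
        (μ.withDensity (fun x => G x ^ (1 / ϑ)) Q / μ Q) ^ ϑ) x ^ q ∂μ ≤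
        c * (K ^ γ * (Y ^ P0 * ∏ j, N j)) ^ q := by
      intro α
      have := (appA (μ := μ) hP he (θ := θ) (e0 := ϑ) (P0 := P0) (q := q) (γ := γ) hθ hP0.le
        (by rw [hϑd, hP0d, hθd]; ring) hq (by rw [hPp, hP0d]; ring) hγ1 hγ hγ0 hω hω0 hωt (hD α) (hL α)
        (hm α) (hμ0 α) (hμt α) hKt (hK α) hF hN
        (φ := fun x => G x ^ (1 / ϑ) * (W x ^ (1 / θ))⁻¹)
        ((hGm.pow_const _).mul (hWm.pow_const _).inv) (N0 := Y ^ P0) hN0).2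
      rw [wd_wd (hWm.pow_const _) (fun x => (ENNReal.rpow_pos (pos_iff_ne_zero.2 (hW0 x)) (hWt x)).ne')
        (fun x => ENNReal.rpow_ne_top_of_ne_zero (hW0 x) (hWt x)) (hGm.pow_const _)] at this
      exact this
    have hM : Y ≤ (C * (Fintype.card A * c) ^ (1 / q) * Z) ^ q * Y ^ (P0 * q) := by
      calc Y ≤ ∫⁻ x, (h x * G x) ^ q ∂μ := by
            refine lintegral_mono fun x => ?_
            have h1 : U x ≤ h x * W x := trunc_le _ _ _ _
            have h2 : U x ^ p = (U x * U x ^ u) ^ q := by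
              rw [show U x * U x ^ u = U x ^ (1 + u) by
                rw [ENNReal.rpow_add_of_nonneg _ _ zero_le_one hu0.le, ENNReal.rpow_one],
                ← ENNReal.rpow_mul]
              congr 1; rw [hu]; field_simp; ring
            rw [h2, hG]
            refine ENNReal.rpow_le_rpow ?_ hq.le
            simp only
            rw [← mul_assoc]
            exact mul_le_mul_left h1 _
        _ ≤ _ := hT G hGm
        _ ≤ C ^ q * ∑ α : A, c * (K ^ γ * (Y ^ P0 * ∏ j, N j)) ^ q :=
            mul_le_mul_right (Finset.sum_le_sum fun α _ => hA α) _
        _ = _ := by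
            rw [Finset.sum_const, Finset.card_univ, nsmul_eq_mul, hZ, ENNReal.mul_rpow_of_nonneg _ _ hq.le,
              ENNReal.mul_rpow_of_nonneg _ _ hq.le, ENNReal.mul_rpow_of_nonneg _ _ hq.le,
              ENNReal.mul_rpow_of_nonneg _ _ hq.le, ENNReal.mul_rpow_of_nonneg _ _ hq.le,
              ← ENNReal.rpow_mul Y, ← ENNReal.rpow_mul (_ * c), one_div_mul_cancel hq.ne', ENNReal.rpow_one]
            ring
    have hYY : Y ^ (P0 * q) ≠ 0 := (ENNReal.rpow_pos (pos_iff_ne_zero.2 hY0) hYt).ne'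
    have hYYt : Y ^ (P0 * q) ≠ ∞ := ENNReal.rpow_ne_top_of_ne_zero hY0 hYt
    have h3 : Y ^ (q / p) ≤ (C * (Fintype.card A * c) ^ (1 / q) * Z) ^ q := by
      have : Y = Y ^ (q / p) * Y ^ (P0 * q) := by
        rw [← ENNReal.rpow_add _ _ hY0 hYt]
        nth_rw 1 [← ENNReal.rpow_one Y]
        congr 1; rw [hP0d]; field_simp; ring
      rw [this] at hM
      rw [this] at hYY hYYt
      rw [← this] at hYY hYYt
      exact (ENNReal.mul_le_mul_iff_left hYY hYYt).1 (by rw [← this] at hM ⊢; exact hM)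
    calc Y = (Y ^ (q / p)) ^ (p / q) := by
          rw [← ENNReal.rpow_mul, div_mul_div_cancel₀ hp.ne', div_self hq.ne', ENNReal.rpow_one]
      _ ≤ ((C * (Fintype.card A * c) ^ (1 / q) * Z) ^ q) ^ (p / q) :=
          ENNReal.rpow_le_rpow h3 (by positivity)
      _ = _ := by rw [← ENNReal.rpow_mul, mul_div_cancel₀ _ hq.ne']
  have := trunc_lint (μ := μ) (monotone_spanningSets μ) (measurableSet_spanningSets μ) hU (hh.mul hWm)
    (measurable_const (a := (1:ℝ≥0∞))) hp key
  simpa using this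

end S7

namespace S7
variable {X : Type*} [MeasurableSpace X]

def lowC {m : ℕ} (e : Fin m → ℝ) (p S : ℝ) : ℝ≥0∞ :=
  Aconst e ^ p * (ENNReal.ofReal (1 / (1 - p * S)) * 2)

/-- algebra for the lowering step -/
theorem alg1 {a y : ℝ≥0∞} (hy0 : y ≠ 0) (hyt : y ≠ ∞) {p q S : ℝ} (hp : 0 < p) (hq : 0 < q)
    (hpq : p ≤ q) (hSp : S < 1 / p) :
    (a * (y ^ (1 / q - S) * ((a * (y⁻¹) ^ S) ^ p) ^ (-(1 / p - 1 / q)))) ^ q ≤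
      (a * y ^ (1 / p - S)) ^ p := by
  by_cases ha0 : a = 0
  · simp [ha0, hq]
  by_cases hat : a = ∞
  · have : (a * y ^ (1 / p - S)) ^ p = ∞ := by
      rw [hat, ENNReal.top_mul (ENNReal.rpow_pos (pos_iff_ne_zero.2 hy0) hyt).ne', ENNReal.top_rpow_of_pos hp]
    rw [this]; exact le_top
  · have h1 : (y⁻¹) ^ S = y ^ (-S) := by rw [ENNReal.rpow_neg, ENNReal.inv_rpow]
    have h2 : (((a * (y⁻¹) ^ S) ^ p) ^ (-(1 / p - 1 / q))) =
        a ^ (-(1 - p / q)) * y ^ (S * (1 - p / q)) := by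
      rw [h1, ← ENNReal.rpow_mul, ENNReal.mul_rpow_of_ne_top hat (ENNReal.rpow_ne_top_of_ne_zero hy0 hyt),
        ← ENNReal.rpow_mul]
      congr 2 <;> field_simp <;> ring
    rw [h2, ENNReal.mul_rpow_of_nonneg _ _ hp.le]
    apply le_of_eq
    have h3 : a * (y ^ (1 / q - S) * (a ^ (-(1 - p / q)) * y ^ (S * (1 - p / q)))) =
        a ^ (p / q) * y ^ ((1 / p - S) * p / q) := by
      calc _ = (a ^ (1:ℝ) * a ^ (-(1 - p / q))) * (y ^ (1 / q - S) * y ^ (S * (1 - p / q))) := by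
            rw [ENNReal.rpow_one]; ring
        _ = _ := by
            rw [← ENNReal.rpow_add _ _ ha0 hat, ← ENNReal.rpow_add _ _ hy0 hyt]
            congr 2
            · ring
            · field_simp; ring
    rw [h3, ENNReal.mul_rpow_of_nonneg _ _ hq.le, ← ENNReal.rpow_mul, ← ENNReal.rpow_mul, ← ENNReal.rpow_mul,
      div_mul_cancel₀ _ hq.ne', div_mul_cancel₀ _ hq.ne']

/-- algebra for the Hölder step -/
theorem alg2 {h W V : ℝ≥0∞} (hW0 : W ≠ 0) (hWt : W ≠ ∞) (hV0 : V ≠ 0) (hVt : V ≠ ∞) {p q S : ℝ}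
    (hp : 0 < p) (hq : 0 < q) (hpq : p ≤ q) (hSp : S < 1 / p) :
    (h * W) ^ p = ((h * (W ^ ((1 / q - S) / (1 / p - S)) * V ^ (-(1 / p - 1 / q)))) ^ q) ^ (p / q) *
      (V * W ^ (1 / (1 / p - S))) ^ (1 - p / q) := by
  have hθ : 0 < 1 / p - S := by linarith
  have hpq' : 0 ≤ 1 - p / q := by rw [sub_nonneg, div_le_one hq]; exact hpq
  rw [← ENNReal.rpow_mul, mul_div_cancel₀ _ hq.ne', ENNReal.mul_rpow_of_nonneg _ _ hp.le,
    ENNReal.mul_rpow_of_nonneg _ _ hp.le, ENNReal.mul_rpow_of_nonneg _ _ hp.le,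
    ENNReal.mul_rpow_of_nonneg _ _ hpq', ← ENNReal.rpow_mul, ← ENNReal.rpow_mul, ← ENNReal.rpow_mul]
  calc h ^ p * W ^ p = h ^ p * (W ^ ((1 / q - S) / (1 / p - S) * p) * W ^ (1 / (1 / p - S) * (1 - p / q))) *
        (V ^ (-(1 / p - 1 / q) * p) * V ^ (1 - p / q)) := by
        rw [← ENNReal.rpow_add _ _ hW0 hWt, ← ENNReal.rpow_add _ _ hV0 hVt]
        have e1 : -(1 / p - 1 / q) * p + (1 - p / q) = 0 := by field_simp; ring
        have e2 : (1 / q - S) / (1 / p - S) * p + 1 / (1 / p - S) * (1 - p / q) = p := by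
          have : (1 / p - S) ≠ 0 := hθ.ne'
          rw [div_mul_eq_mul_div, one_div_mul_eq_div, ← add_div, div_eq_iff this]
          field_simp; ring
        rw [e1, e2, ENNReal.rpow_zero, mul_one]
    _ = _ := by ring

theorem coreLo {m : ℕ} {μ : Measure X} [SigmaFinite μ] {e P : Fin m → ℝ} (hP : ∀ j, 0 ≤ P j)
    (he : ∀ j, P j < e j) {A : Type*} [Fintype A] {q S p γ : ℝ} (hq : 0 < q) (hp : 0 < p)
    (hPp : ∑ j, P j = 1 / p) (hS : 0 ≤ S) (hSp : S < 1 / p) (hpq : p ≤ q) (hSq : S < 1 / q)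
    (hγ1 : 1 ≤ γ) (hγ : ∀ j, e j ≤ γ * (e j - P j))
    {ω : Fin m → X → ℝ≥0∞} (hω : ∀ j, Measurable (ω j))
    (hω0 : ∀ j x, ω j x ≠ 0) (hωt : ∀ j x, ω j x ≠ ∞)
    {D : A → Set (Set X)} (hD : ∀ α, (D α).Countable) (hL : ∀ α, Lam (D α))
    (hm : ∀ α, ∀ Q ∈ D α, MeasurableSet Q) (hμ0 : ∀ α, ∀ Q ∈ D α, μ Q ≠ 0)
    (hμt : ∀ α, ∀ Q ∈ D α, μ Q ≠ ∞)
    {K : ℝ≥0∞} (hKt : K ≠ ∞)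
    (hK : ∀ α, ∀ Q ∈ D α, (μ.withDensity (fun x => (∏ j, ω j x) ^ (1 / (1 / p - S))) Q / μ Q) ^ (1 / p - S) *
      ∏ j, (μ.withDensity (fun x => ω j x ^ (-1 / (e j - P j))) Q / μ Q) ^ (e j - P j) ≤ K)
    {F : Fin m → X → ℝ≥0∞} (hF : ∀ j, Measurable (F j)) {N : Fin m → ℝ≥0∞}
    (hN : ∀ j, (0 < P j ∧ ∫⁻ x, (F j x * ω j x) ^ (1 / P j) ∂μ ≤ N j ^ (1 / P j)) ∨
      (P j = 0 ∧ ∀ᵐ x ∂μ, F j x * ω j x ≤ N j))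
    {h : X → ℝ≥0∞} (hh : Measurable h) {C : ℝ≥0∞}
    (hT : ∀ G : X → ℝ≥0∞, Measurable G → ∫⁻ x, (h x * G x) ^ q ∂μ ≤ C ^ q *
      ∑ α, ∫⁻ x, mx (D α) (fun Q => pav μ (fun j => μ.withDensity fun x => F j x ^ (1 / e j)) e Q *
        (μ.withDensity (fun x => G x ^ (1 / (1 / q - S))) Q / μ Q) ^ (1 / q - S)) x ^ q ∂μ) :
    ∫⁻ x, (h x * ∏ j, ω j x) ^ p ∂μ ≤
      ((Fintype.card A) * cstA (fun o : Option (Fin m) => o.elim (1 / p - S) e)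
        (fun o => o.elim 0 P) p γ + 1) * (2 * lowC e p S) ^ (1 - p / q) * (C * (K ^ γ * ∏ j, N j)) ^ p := by
  set W : X → ℝ≥0∞ := fun x => ∏ j, ω j x with hW
  have hWm : Measurable W := Finset.measurable_fun_prod _ fun j _ => hω j
  have hW0 : ∀ x, W x ≠ 0 := fun x => Finset.prod_ne_zero_iff.2 fun j _ => hω0 j x
  have hWt : ∀ x, W x ≠ ∞ := fun x => ENNReal.prod_ne_top fun j _ => hωt j x
  have hθ : 0 < 1 / p - S := by linarith
  have hϑ : 0 < 1 / q - S := by linarith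
  have he0 : ∀ j, 0 < e j := fun j => (hP j).trans_lt (he j)
  have hpS : p * S < 1 := by rw [lt_div_iff₀ hp] at hSp; linarith
  have hpq' : 0 ≤ 1 - p / q := by rw [sub_nonneg, div_le_one hq]; exact hpq
  have hPQ : 0 ≤ 1 / p - 1 / q := by
    have := one_div_le_one_div_of_le hp hpq
    linarith
  set θ := 1 / p - S with hθd
  set a := pav μ (fun j => μ.withDensity fun x => F j x ^ (1 / e j)) e with ha
  set ν := μ.withDensity (fun x => W x ^ (1 / θ)) with hν
  set c := cstA (fun o : Option (Fin m) => o.elim θ e) (fun o => o.elim 0 P) p γ with hc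
  set Z := K ^ γ * ∏ j, N j with hZ
  set low := lowC e p S with hlow
  set c1 := (Fintype.card A) * c + 1 with hc1
  have hσm : Measurable fun x => W x ^ (1 / θ) := hWm.pow_const _
  have hσ0 : ∀ x, W x ^ (1 / θ) ≠ 0 := fun x => (ENNReal.rpow_pos (pos_iff_ne_zero.2 (hW0 x)) (hWt x)).ne'
  have hσt : ∀ x, W x ^ (1 / θ) ≠ ∞ := fun x => ENNReal.rpow_ne_top_of_ne_zero (hW0 x) (hWt x)
  have hν0 : ∀ α, ∀ Q ∈ D α, ν Q ≠ 0 := fun α Q hQ => wd_ne_zero hσm hσ0 (hμ0 α Q hQ)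
  have hA0 := fun α => appA (μ := μ) hP he (θ := θ) (e0 := θ) (P0 := 0) (q := p) (γ := γ) hθ le_rfl
        (by ring) hp (by rw [hPp]; ring) hγ1 hγ (by nlinarith) hω hω0 hωt (hD α) (hL α)
        (hm α) (hμ0 α) (hμt α) hKt (hK α) hF hN
        (φ := fun x => 1) measurable_const (N0 := 1) (Or.inr ⟨rfl, by simp⟩)
  have hνt : ∀ α, ∀ Q ∈ D α, ν Q ≠ ∞ := fun α => (hA0 α).1
  have hA : ∀ α, ∫⁻ x, mx (D α) (fun Q => a Q * (ν Q / μ Q) ^ θ) x ^ p ∂μ ≤ c * Z ^ p := by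
    intro α
    have := (hA0 α).2
    have h1 : (μ.withDensity fun x => (∏ j, ω j x) ^ (1 / θ)).withDensity (fun _ => (1:ℝ≥0∞)) = ν :=
      withDensity_one
    rw [h1, one_mul] at this
    exact this
  -- reduction to `h = 0` almost everywhere
  have hzero : (∫⁻ x, (h x * 1) ^ q ∂μ ≤ 0) → ∫⁻ x, (h x * W x) ^ p ∂μ = 0 := by
    intro h0
    have h1 := (lintegral_eq_zero_iff ((hh.mul measurable_const).pow_const q)).1 (le_antisymm h0 zero_le)
    rw [lintegral_eq_zero_iff (show Measurable fun x => (h x * W x) ^ p from (hh.mul hWm).pow_const p)]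
    filter_upwards [h1] with x hx
    have hx' : (h x * 1) ^ q = 0 := hx
    rw [mul_one, ENNReal.rpow_eq_zero_iff_of_pos hq] at hx'
    simp [hx', hp]
  by_cases hC0 : C = 0
  · rw [hzero]
    · exact zero_le
    · refine (hT (fun _ => 1) measurable_const).trans ?_
      rw [hC0, ENNReal.zero_rpow_of_pos hq, zero_mul]
  by_cases hZ0 : Z = 0
  · rw [hzero]
    · exact zero_le
    · refine (hT (fun _ => 1) measurable_const).trans ?_
      rw [Finset.sum_eq_zero, mul_zero]
      intro α _
      have haQ : ∀ Q ∈ D α, a Q = 0 := by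
        intro Q hQ
        have h1 := hA α
        rw [hZ0, ENNReal.zero_rpow_of_pos hp, mul_zero] at h1
        have h2 : (a Q * (ν Q / μ Q) ^ θ) ^ p * μ Q ≤ 0 := by
          refine le_trans ?_ h1
          rw [← setLIntegral_const]
          refine (setLIntegral_mono' (hm α Q hQ) fun x hx => ?_).trans (setLIntegral_le_lintegral Q _)
          exact ENNReal.rpow_le_rpow (le_mx (fun Q => a Q * (ν Q / μ Q) ^ θ) hQ hx) hp.le
        have h3 := le_antisymm h2 zero_le
        rw [mul_eq_zero, or_iff_left (hμ0 α Q hQ), ENNReal.rpow_eq_zero_iff_of_pos hp, mul_eq_zero,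
          ENNReal.rpow_eq_zero_iff_of_pos hθ, ENNReal.div_eq_zero_iff] at h3
        rcases h3 with h3 | h3 | h3
        · exact h3
        · exact absurd h3 (hν0 α Q hQ)
        · exact absurd h3 (hμt α Q hQ)
      rw [lintegral_eq_zero_iff' ]
      · refine Filter.Eventually.of_forall fun x => ?_
        have : mx (D α) (fun Q => a Q * (μ.withDensity (fun x => (1:ℝ≥0∞) ^ (1 / (1 / q - S))) Q / μ Q) ^
            (1 / q - S)) x ≤ 0 := mx_le fun Q hQ _ => by rw [haQ Q hQ, zero_mul]
        simp only [Pi.zero_apply]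
        rw [le_antisymm this zero_le, ENNReal.zero_rpow_of_pos hq]
      · exact ((measurable_mx (hD α) (hm α) _).pow_const _).aemeasurable
  have hc10 : c1 ≠ 0 := by rw [hc1]; simp
  have hlow0 : low ≠ 0 := by
    rw [hlow, lowC]
    refine mul_ne_zero ?_ (mul_ne_zero ?_ (by simp))
    · have := Aconst_ge e he0
      exact (zero_lt_one.trans_le (ENNReal.one_le_rpow this hp)).ne'
    · rw [Ne, ENNReal.ofReal_eq_zero, not_le]
      have : 0 < 1 - p * S := by linarith
      positivity
  have hlowt : low ≠ ∞ := by
    rw [hlow, lowC]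
    exact ENNReal.mul_ne_top (ENNReal.rpow_ne_top_of_nonneg hp.le (Aconst_ne e he0))
      (ENNReal.mul_ne_top ENNReal.ofReal_ne_top (by simp))
  have hct : c1 ≠ ∞ := by
    rw [hc1]
    refine ENNReal.add_ne_top.2 ⟨ENNReal.mul_ne_top (by simp) (cstA_ne_top ?_ ?_ hp), by simp⟩
    · rintro (_ | j)
      · exact le_rfl
      · exact hP j
    · rintro (_ | j)
      · exact hθ
      · exact he j
  by_cases hCZ : C * Z = ∞
  · rw [hCZ, ENNReal.top_rpow_of_pos hp, ENNReal.mul_top]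
    · exact le_top
    · refine mul_ne_zero hc10 (ENNReal.rpow_pos (pos_iff_ne_zero.2 (mul_ne_zero (by simp) hlow0))
        (ENNReal.mul_ne_top (by simp) hlowt)).ne'
  have hZt : Z ≠ ∞ := fun hZt => hCZ (by rw [hZt, ENNReal.mul_top hC0])
  set B := c1 * Z ^ p with hB
  have hB0 : B ≠ 0 := mul_ne_zero hc10 (ENNReal.rpow_pos (pos_iff_ne_zero.2 hZ0) hZt).ne'
  have hBt : B ≠ ∞ := ENNReal.mul_ne_top hct (ENNReal.rpow_ne_top_of_nonneg hp.le hZt)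
  have hBsum : ∑ α, ∫⁻ x, mx (D α) (fun Q => a Q * (ν Q / μ Q) ^ θ) x ^ p ∂μ ≤ B := by
    refine (Finset.sum_le_sum fun α _ => hA α).trans ?_
    rw [Finset.sum_const, Finset.card_univ, nsmul_eq_mul, ← mul_assoc, hB, hc1]
    exact mul_le_mul_left le_self_add _
  -- the lowered maximal function
  set L : A → X → ℝ≥0∞ := fun α => mx (D α) (fun Q => a Q * (μ Q / ν Q) ^ S) with hLdef
  have hLm : ∀ α, Measurable (L α) := fun α => measurable_mx (hD α) (hm α) _
  have hLB : ∑ α, ∫⁻ x, L α x ^ p ∂ν ≤ low * B := by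
    refine (Finset.sum_le_sum fun α _ => lower he0 hp hS hpS (hD α) (hL α) (hm α) (hμ0 α) (hμt α)
      (hν0 α) (hνt α)).trans ?_
    rw [← Finset.mul_sum]
    exact mul_le_mul_right hBsum _
  obtain ⟨H0, hH0, hH0m, hH0i⟩ := exists_pos_lintegral_lt_of_sigmaFinite μ (mul_ne_zero hlow0 hB0)
  set V : X → ℝ≥0∞ := fun x => (∑ α, L α x ^ p) + H0 x * (W x ^ (1 / θ))⁻¹ with hV
  have hVm : Measurable V := (Finset.measurable_fun_sum _ fun α _ => (hLm α).pow_const _).add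
    (hH0m.coe_nnreal_ennreal.mul hσm.inv)
  have hV0 : ∀ x, V x ≠ 0 := by
    intro x h0
    have h1 := (add_eq_zero.1 h0).2
    rw [mul_eq_zero] at h1
    rcases h1 with h1 | h1
    · exact (hH0 x).ne' (by exact_mod_cast h1)
    · exact ENNReal.inv_ne_zero.2 (hσt x) h1
  have hVi : ∫⁻ x, V x * W x ^ (1 / θ) ∂μ ≤ 2 * low * B := by
    have h1 : ∀ x, V x * W x ^ (1 / θ) = (∑ α, W x ^ (1 / θ) * L α x ^ p) + H0 x := by
      intro x
      rw [hV]
      simp only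
      rw [add_mul, Finset.sum_mul, mul_assoc, ENNReal.inv_mul_cancel (hσ0 x) (hσt x), mul_one]
      simp only [mul_comm]
    simp only [h1]
    rw [lintegral_add_right _ hH0m.coe_nnreal_ennreal,
      lintegral_finsetSum _ fun α _ => (show Measurable fun x => W x ^ (1 / θ) * L α x ^ p from
        hσm.mul ((hLm α).pow_const _))]
    rw [mul_assoc, two_mul]
    refine add_le_add (le_of_eq_of_le (Finset.sum_congr rfl fun α _ => ?_) hLB) hH0i.le
    rw [hν, lintegral_withDensity_eq_lintegral_mul _ hσm ((hLm α).pow_const p)]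
    rfl
  have hVt : ∀ᵐ x ∂μ, V x ≠ ∞ := by
    have h1 := ae_lt_top (hVm.mul hσm) (ne_top_of_le_ne_top
      (ENNReal.mul_ne_top (ENNReal.mul_ne_top (by simp) hlowt) hBt) hVi)
    filter_upwards [h1] with x hx hVx
    rw [Pi.mul_apply, hVx, ENNReal.top_mul (hσ0 x)] at hx
    exact lt_irrefl _ hx
  set G : X → ℝ≥0∞ := fun x => W x ^ ((1 / q - S) / θ) * V x ^ (-(1 / p - 1 / q)) with hG
  have hGm : Measurable G := (hWm.pow_const _).mul (hVm.pow_const _)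
  have hGq : ∫⁻ x, (h x * G x) ^ q ∂μ ≤ C ^ q * B := by
    refine (hT G hGm).trans (mul_le_mul_right (le_trans (Finset.sum_le_sum fun α _ => ?_) hBsum) _)
    refine lintegral_mono fun x => ?_
    refine (le_rpow_one_div_iff' hq).1 (mx_le fun Q hQ hx => (le_rpow_one_div_iff' hq).2 ?_)
    refine le_trans ?_ (ENNReal.rpow_le_rpow (le_mx (fun Q => a Q * (ν Q / μ Q) ^ θ) hQ hx) hp.le)
    have hy0 : ν Q / μ Q ≠ 0 := by simp [ENNReal.div_eq_zero_iff, hν0 α Q hQ, hμt α Q hQ]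
    have hyt : ν Q / μ Q ≠ ∞ := ENNReal.div_ne_top (hνt α Q hQ) (hμ0 α Q hQ)
    refine le_trans (ENNReal.rpow_le_rpow (mul_le_mul_right ?_ _) hq.le)
      (alg1 (a := a Q) hy0 hyt hp hq hpq hSp)
    rw [ENNReal.inv_div (Or.inl (hμt α Q hQ)) (Or.inl (hμ0 α Q hQ))]
    set b := (a Q * (μ Q / ν Q) ^ S) ^ p with hb
    have hbV : ∀ x ∈ Q, b ≤ V x := by
      intro x hx
      refine le_trans ?_ le_self_add
      refine le_trans ?_ (Finset.single_le_sum (f := fun α => L α x ^ p) (fun _ _ => zero_le)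
        (Finset.mem_univ α))
      exact ENNReal.rpow_le_rpow (le_mx (fun Q => a Q * (μ Q / ν Q) ^ S) hQ hx) hp.le
    have hInt0 : μ.withDensity (fun x => G x ^ (1 / (1 / q - S))) Q ≤
        ν Q * (b ^ (-(1 / p - 1 / q))) ^ (1 / (1 / q - S)) := by
      rw [withDensity_apply _ (hm α Q hQ), hν, withDensity_apply _ (hm α Q hQ),
        ← lintegral_mul_const _ hσm]
      refine setLIntegral_mono' (hm α Q hQ) fun x hx => ?_
      rw [hG]
      simp only
      rw [ENNReal.mul_rpow_of_nonneg _ _ (by positivity), ← ENNReal.rpow_mul (W x),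
        show (1 / q - S) / θ * (1 / (1 / q - S)) = 1 / θ by
          rw [mul_one_div, div_right_comm, div_self hϑ.ne']]
      exact mul_le_mul_right (ENNReal.rpow_le_rpow (rpow_anti (by linarith) (hbV x hx)) (by positivity)) _
    calc (μ.withDensity (fun x => G x ^ (1 / (1 / q - S))) Q / μ Q) ^ (1 / q - S)
        ≤ (ν Q / μ Q * (b ^ (-(1 / p - 1 / q))) ^ (1 / (1 / q - S))) ^ (1 / q - S) := by
          refine ENNReal.rpow_le_rpow ((ENNReal.div_le_div_right hInt0 _).trans_eq ?_) hϑ.le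
          simp only [div_eq_mul_inv]; ring
      _ = _ := by
          rw [ENNReal.mul_rpow_of_nonneg _ _ hϑ.le, ← ENNReal.rpow_mul (b ^ _), one_div_mul_cancel hϑ.ne',
            ENNReal.rpow_one]
  calc ∫⁻ x, (h x * W x) ^ p ∂μ
      = ∫⁻ x, ((h x * G x) ^ q) ^ (p / q) * (V x * W x ^ (1 / θ)) ^ (1 - p / q) ∂μ := by
        refine lintegral_congr_ae ?_
        filter_upwards [hVt] with x hx
        exact alg2 (hW0 x) (hWt x) (hV0 x) hx hp hq hpq hSp
    _ ≤ (∫⁻ x, (h x * G x) ^ q ∂μ) ^ (p / q) * (∫⁻ x, V x * W x ^ (1 / θ) ∂μ) ^ (1 - p / q) :=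
        ENNReal.lintegral_mul_norm_pow_le ((hh.mul hGm).pow_const q).aemeasurable (hVm.mul hσm).aemeasurable
          (by positivity) hpq' (by ring)
    _ ≤ (C ^ q * B) ^ (p / q) * (2 * low * B) ^ (1 - p / q) :=
        mul_le_mul' (ENNReal.rpow_le_rpow hGq (by positivity)) (ENNReal.rpow_le_rpow hVi hpq')
    _ = C ^ p * (B ^ (p / q) * B ^ (1 - p / q)) * (2 * low) ^ (1 - p / q) := by
        rw [ENNReal.mul_rpow_of_nonneg _ _ (by positivity), ENNReal.mul_rpow_of_nonneg _ _ hpq',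
          ← ENNReal.rpow_mul C, mul_div_cancel₀ _ hq.ne']
        ring
    _ = _ := by
        rw [← ENNReal.rpow_add _ _ hB0 hBt, add_sub_cancel, ENNReal.rpow_one, hB,
          ENNReal.mul_rpow_of_nonneg C Z hp.le]
        ring

end S7

namespace S7

theorem core {d m : ℕ} {e P : Fin m → ℝ} (hP : ∀ j, 0 ≤ P j)
    (he : ∀ j, P j < e j) {q S p γ : ℝ} (hq : 0 < q) (hp : 0 < p)
    (hPp : ∑ j, P j = 1 / p) (hS : 0 ≤ S) (hSp : S < 1 / p) (hSq : S < 1 / q)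
    (hγ1 : 1 ≤ γ) (hγ : ∀ j, e j ≤ γ * (e j - P j)) (hγ0 : 1 / q - S ≤ γ * (1 / p - S)) :
    ∃ c : ℝ≥0∞, c ≠ ∞ ∧ ∀ ω : Fin m → (Fin d → ℝ) → ℝ≥0∞, (∀ j, Measurable (ω j)) →
    (∀ j x, ω j x ≠ 0) → (∀ j x, ω j x ≠ ∞) → ∀ K : ℝ≥0∞, K ≠ ∞ →
    (∀ α, ∀ Q ∈ grid (d := d) α, (volume.withDensity (fun x => (∏ j, ω j x) ^ (1 / (1 / p - S))) Q / volume Q) ^ (1 / p - S) *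
      ∏ j, (volume.withDensity (fun x => ω j x ^ (-1 / (e j - P j))) Q / volume Q) ^ (e j - P j) ≤ K) →
    ∀ F : Fin m → (Fin d → ℝ) → ℝ≥0∞, (∀ j, Measurable (F j)) → ∀ N : Fin m → ℝ≥0∞,
    (∀ j, (0 < P j ∧ ∫⁻ x, (F j x * ω j x) ^ (1 / P j) ≤ N j ^ (1 / P j)) ∨
      (P j = 0 ∧ ∀ᵐ x, F j x * ω j x ≤ N j)) →
    ∀ h : (Fin d → ℝ) → ℝ≥0∞, Measurable h → ∀ C : ℝ≥0∞,
    (∀ G : (Fin d → ℝ) → ℝ≥0∞, Measurable G → ∫⁻ x, (h x * G x) ^ q ≤ C ^ q *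
      ∑ α, ∫⁻ x, mx (grid (d := d) α) (fun Q => pav volume (fun j => volume.withDensity fun x => F j x ^ (1 / e j)) e Q *
        (volume.withDensity (fun x => G x ^ (1 / (1 / q - S))) Q / volume Q) ^ (1 / q - S)) x ^ q) →
    (∫⁻ x, (h x * ∏ j, ω j x) ^ p) ^ (1 / p) ≤ c * C * K ^ γ * ∏ j, N j := by
  have hmm : ∀ α, ∀ Q ∈ grid (d := d) α, MeasurableSet Q := by
    intro α Q hQ
    obtain ⟨R, rfl⟩ := grid_cube hQ
    exact cube_meas R
  have h0 : ∀ α, ∀ Q ∈ grid (d := d) α, volume Q ≠ 0 := by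
    intro α Q hQ
    obtain ⟨R, rfl⟩ := grid_cube hQ
    exact cube_vol_ne_zero R
  have ht : ∀ α, ∀ Q ∈ grid (d := d) α, volume Q ≠ ∞ := by
    intro α Q hQ
    obtain ⟨R, rfl⟩ := grid_cube hQ
    exact cube_vol_ne_top R
  rcases lt_or_ge q p with hpq | hpq
  · refine ⟨((Fintype.card (Fin d → Bool)) * cstA (fun o : Option (Fin m) => o.elim (1 / q - S) e)
        (fun o => o.elim (1 / q - 1 / p) P) q γ) ^ (1 / q), ?_, ?_⟩
    · refine ENNReal.rpow_ne_top_of_nonneg (by positivity) (ENNReal.mul_ne_top (by simp) (cstA_ne_top ?_ ?_ hq))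
      · rintro (_ | j)
        · have := one_div_le_one_div_of_le hq hpq.le
          simp only [Option.elim]; linarith
        · exact hP j
      · rintro (_ | j)
        · simp only [Option.elim]; linarith
        · exact he j
    · intro ω hω hω0 hωt K hKt hK F hF N hN h hh C hT
      rw [rpow_one_div_le_iff' hp]
      refine (coreHi hP he hq hp hPp hS hSp hpq hγ1 hγ hγ0 hω hω0 hωt grid_countable grid_lam hmm h0 ht
        hKt hK hF hN hh hT).trans_eq ?_
      congr 1
      ring
  · refine ⟨(((Fintype.card (Fin d → Bool)) * cstA (fun o : Option (Fin m) => o.elim (1 / p - S) e)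
        (fun o => o.elim 0 P) p γ + 1) * (2 * lowC e p S) ^ (1 - p / q)) ^ (1 / p), ?_, ?_⟩
    · refine ENNReal.rpow_ne_top_of_nonneg (by positivity) (ENNReal.mul_ne_top
        (ENNReal.add_ne_top.2 ⟨ENNReal.mul_ne_top (by simp) (cstA_ne_top ?_ ?_ hp), by simp⟩) ?_)
      · rintro (_ | j)
        · simp
        · exact hP j
      · rintro (_ | j)
        · simp only [Option.elim]; linarith
        · exact he j
      · refine ENNReal.rpow_ne_top_of_nonneg ?_ (ENNReal.mul_ne_top (by simp) ?_)
        · rw [sub_nonneg, div_le_one hq]; exact hpq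
        · unfold lowC
          exact ENNReal.mul_ne_top (ENNReal.rpow_ne_top_of_nonneg hp.le (Aconst_ne e fun j => (hP j).trans_lt (he j)))
            (ENNReal.mul_ne_top ENNReal.ofReal_ne_top (by simp))
    · intro ω hω hω0 hωt K hKt hK F hF N hN h hh C hT
      rw [rpow_one_div_le_iff' hp]
      refine (coreLo hP he hq hp hPp hS hSp hpq hSq hγ1 hγ hω hω0 hωt grid_countable grid_lam hmm h0 ht
        hKt hK hF hN hh hT).trans_eq ?_
      rw [mul_assoc (_ * C), mul_assoc _ C, ENNReal.mul_rpow_of_nonneg _ (C * _) hp.le, ← ENNReal.rpow_mul, one_div_mul_cancel hp.ne',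
        ENNReal.rpow_one]

theorem avg_eq {d : ℕ} {r : ℝ≥0∞} {e : ℝ} (hr : r ≠ ∞) (h : r.toReal = 1 / e) (F : (Fin d → ℝ) → ℝ≥0∞) (Q : Cube d) :
    avg r F Q = (volume.withDensity (fun x => F x ^ (1 / e)) Q.set / volume Q.set) ^ e := by
  unfold avg Cube.vol
  rw [if_neg hr, withDensity_apply _ (cube_meas Q), h, one_div_one_div]

theorem div_cover {d : ℕ} (I : Measure (Fin d → ℝ)) {Q : Cube d} {R : Set (Fin d → ℝ)} (h1 : Q.set ⊆ R)
    (h2 : volume R ≤ 6 ^ d * volume Q.set) (hR0 : volume R ≠ 0) (hRt : volume R ≠ ∞) :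
    I Q.set / volume Q.set ≤ 6 ^ d * (I R / volume R) := by
  rw [ENNReal.div_le_iff (cube_vol_ne_zero Q) (cube_vol_ne_top Q)]
  calc I Q.set ≤ I R := measure_mono h1
    _ = I R / volume R * volume R := (ENNReal.div_mul_cancel hR0 hRt).symm
    _ ≤ I R / volume R * (6 ^ d * volume Q.set) := mul_le_mul_right h2 _
    _ = _ := by ring

theorem maxi {d m : ℕ} {r : Fin m → ℝ≥0∞} {ρ : ℝ≥0∞} {e : Fin m → ℝ} {t q : ℝ} (he : ∀ j, 0 < e j) (ht : 0 < t)
    (hq : 0 < q)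
    (hr : ∀ j, r j ≠ ∞) (hre : ∀ j, (r j).toReal = 1 / e j) (hρ : ρ ≠ ∞) (hρt : ρ.toReal = 1 / t)
    (F : Fin m → (Fin d → ℝ) → ℝ≥0∞) (G : (Fin d → ℝ) → ℝ≥0∞) (x : Fin d → ℝ) :
    maximalX r ρ F G x ^ q ≤ ((∏ j, ((6:ℝ≥0∞) ^ d) ^ e j) * ((6:ℝ≥0∞) ^ d) ^ t) ^ q *
      ∑ α, mx (grid (d := d) α) (fun Q => pav volume (fun j => volume.withDensity fun x => F j x ^ (1 / e j)) e Q *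
        (volume.withDensity (fun x => G x ^ (1 / t)) Q / volume Q) ^ t) x ^ q := by
  rw [← le_rpow_one_div_iff' hq]
  unfold maximalX
  refine iSup₂_le fun Q hx => ?_
  obtain ⟨α, R, hR, hQR, hv⟩ := cover Q
  obtain ⟨R, rfl⟩ := grid_cube hR
  have hR0 := cube_vol_ne_zero R
  have hRt := cube_vol_ne_top R
  rw [le_rpow_one_div_iff' hq]
  refine le_trans ?_ (mul_le_mul_right (Finset.single_le_sum (f := fun α => mx (grid (d := d) α) (fun Q => pav volume (fun j => volume.withDensity fun x => F j x ^ (1 / e j)) e Q *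
        (volume.withDensity (fun x => G x ^ (1 / t)) Q / volume Q) ^ t) x ^ q) (fun _ _ => zero_le) (Finset.mem_univ α)) _)
  rw [← ENNReal.mul_rpow_of_nonneg _ _ hq.le]
  refine ENNReal.rpow_le_rpow ?_ hq.le
  refine le_trans ?_ (mul_le_mul_right (le_mx (fun Q => pav volume (fun j => volume.withDensity fun x => F j x ^ (1 / e j)) e Q *
        (volume.withDensity (fun x => G x ^ (1 / t)) Q / volume Q) ^ t) hR (hQR hx)) _)
  rw [avg_eq hρ hρt]
  simp only [fun j => avg_eq (hr j) (hre j) (F j) Q]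
  unfold pav
  rw [mul_mul_mul_comm, ← Finset.prod_mul_distrib, ← ENNReal.mul_rpow_of_nonneg _ _ ht.le]
  refine mul_le_mul' (Finset.prod_le_prod' fun j _ => ?_) (ENNReal.rpow_le_rpow (div_cover _ hQR hv hR0 hRt) ht.le)
  rw [← ENNReal.mul_rpow_of_nonneg _ _ (he j).le]
  exact ENNReal.rpow_le_rpow (div_cover _ hQR hv hR0 hRt) (he j).le

theorem avg_mono {d : ℕ} (r : ℝ≥0∞) {F G : (Fin d → ℝ) → ℝ≥0∞} (h : ∀ x, F x ≤ G x) (Q : Cube d) :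
    avg r F Q ≤ avg r G Q := by
  unfold avg
  split_ifs
  · exact essSup_mono_ae (Filter.Eventually.of_forall h)
  · refine ENNReal.rpow_le_rpow (ENNReal.div_le_div_right (lintegral_mono fun x =>
      ENNReal.rpow_le_rpow (h x) toReal_nonneg) _) (by positivity)

theorem maximalX_mono {d m : ℕ} (r : Fin m → ℝ≥0∞) (ρ : ℝ≥0∞) (F : Fin m → (Fin d → ℝ) → ℝ≥0∞)
    {G G' : (Fin d → ℝ) → ℝ≥0∞} (h : ∀ x, G x ≤ G' x) (x : Fin d → ℝ) :
    maximalX r ρ F G x ≤ maximalX r ρ F G' x := by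
  unfold maximalX
  exact iSup₂_mono fun Q _ => mul_le_mul_right (avg_mono ρ h Q) _

theorem hypT {d m : ℕ} {r : Fin m → ℝ≥0∞} {ρ q : ℝ≥0∞} {e : Fin m → ℝ} {t : ℝ} (he : ∀ j, 0 < e j) (ht : 0 < t)
    (hq : 0 < q.toReal) (hqt : q ≠ ∞)
    (hr : ∀ j, r j ≠ ∞) (hre : ∀ j, (r j).toReal = 1 / e j) (hρ : ρ ≠ ∞) (hρt : ρ.toReal = 1 / t)
    (F : Fin m → (Fin d → ℝ) → ℝ≥0∞) {h : (Fin d → ℝ) → ℝ≥0∞} (hh : Measurable h) {CT : ℝ≥0∞}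
    (hT : ∀ g : (Fin d → ℝ) → ℂ, MemLinftyC g → eNorm q volume (fun x => h x * nn g x) ≤
            CT * eNorm q volume (maximalX r ρ F (nn g)))
    (G : (Fin d → ℝ) → ℝ≥0∞) (hG : Measurable G) :
    ∫⁻ x, (h x * G x) ^ q.toReal ≤ (CT * ((∏ j, ((6:ℝ≥0∞) ^ d) ^ e j) * ((6:ℝ≥0∞) ^ d) ^ t)) ^ q.toReal *
      ∑ α, ∫⁻ x, mx (grid (d := d) α) (fun Q => pav volume (fun j => volume.withDensity fun x => F j x ^ (1 / e j)) e Q *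
        (volume.withDensity (fun x => G x ^ (1 / t)) Q / volume Q) ^ t) x ^ q.toReal := by
  have hmm : ∀ α, ∀ Q ∈ grid (d := d) α, MeasurableSet Q := by
    intro α Q hQ
    obtain ⟨R, rfl⟩ := grid_cube hQ
    exact cube_meas R
  set B : ℕ → Set (Fin d → ℝ) := fun n => Metric.closedBall 0 n with hB
  have hBm : ∀ n, MeasurableSet (B n) := fun n => Metric.isClosed_closedBall.measurableSet
  refine trunc_lint (B := B) (fun k n hkn => Metric.closedBall_subset_closedBall (by exact_mod_cast hkn)) hBm
    (fun x => ?_) hG hh hq fun n => ?_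
  · obtain ⟨n, hn⟩ := exists_nat_ge (dist x 0)
    exact ⟨n, Metric.mem_closedBall.2 hn⟩
  have htn : ∀ x, trunc B G n x ≤ n := fun x => (trunc_le_nat B G n x).trans
    (Set.indicator_le_self _ _ _)
  have htt : ∀ x, trunc B G n x ≠ ∞ := fun x => ne_top_of_le_ne_top (by simp) (htn x)
  set g : (Fin d → ℝ) → ℂ := fun x => ((trunc B G n x).toReal : ℂ) with hg
  have hnn : nn g = trunc B G n := by
    funext x
    unfold nn
    rw [← enorm_eq_nnnorm, hg]
    simp only
    rw [← ofReal_norm_eq_enorm, Complex.norm_real, Real.norm_of_nonneg toReal_nonneg, ofReal_toReal (htt x)]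
  have hgm : MemLinftyC g := by
    refine ⟨Complex.measurable_ofReal.comp (trunc_meas hBm hG n).ennreal_toReal, ⟨n, fun x => ?_⟩, ?_⟩
    · rw [hg]
      simp only
      rw [Complex.norm_real, Real.norm_of_nonneg toReal_nonneg]
      exact ENNReal.toReal_le_of_le_ofReal (by simp) (by simpa using htn x)
    · refine (Metric.isBounded_closedBall (x := (0 : Fin d → ℝ)) (r := n)).subset fun x hx => ?_
      by_contra hxB
      apply hx
      have : trunc B G n x = 0 := Set.indicator_of_notMem hxB _
      simp [hg, this]
  have h1 := hT g hgm
  unfold eNorm at h1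
  rw [if_neg hqt, if_neg hqt, rpow_one_div_le_iff' hq, ENNReal.mul_rpow_of_nonneg _ _ hq.le, ← ENNReal.rpow_mul,
    one_div_mul_cancel hq.ne', ENNReal.rpow_one, hnn] at h1
  refine h1.trans ?_
  rw [ENNReal.mul_rpow_of_nonneg _ _ hq.le, mul_assoc]
  refine mul_le_mul_right ?_ _
  rw [← lintegral_finsetSum _ fun α _ => (measurable_mx (grid_countable α) (hmm α) _).pow_const _,
    ← lintegral_const_mul _ (Finset.measurable_fun_sum _ fun α _ => (measurable_mx (grid_countable α) (hmm α) _).pow_const _)]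
  refine lintegral_mono fun x => ?_
  exact (ENNReal.rpow_le_rpow (maximalX_mono r ρ F (trunc_le B G n) x) hq.le).trans
    (maxi he ht hq hr hre hρ hρt F G x)

end S7

namespace S7

theorem inv_sub {a b : ℝ≥0∞} (ha : a ≠ ∞) (hab : b < a) :
    (a - b)⁻¹ ≠ ∞ ∧ ((a - b)⁻¹).toReal = 1 / (a.toReal - b.toReal) ∧ b.toReal < a.toReal ∧
      a - b ≠ 0 ∧ a - b ≠ ∞ ∧ (a - b).toReal = a.toReal - b.toReal := by
  have h0 : a - b ≠ 0 := (tsub_pos_of_lt hab).ne'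
  have h1 : (a - b).toReal = a.toReal - b.toReal := ENNReal.toReal_sub_of_le hab.le ha
  refine ⟨ENNReal.inv_ne_top.2 h0, ?_, (ENNReal.toReal_lt_toReal hab.ne_top ha).2 hab, h0,
    (tsub_le_self.trans_lt ha.lt_top).ne, h1⟩
  rw [ENNReal.toReal_inv, h1, one_div]

end S7

/-- weighted bounds from sparse-form domination (formulated via the
multisublinear maximal operator) for an operator defined on simple functions. -/
theorem statement7 (d m : ℕ) (hd : 1 ≤ d) (hm : 1 ≤ m)
    (r : Fin m → ℝ≥0∞) (hr : ∀ j, 0 < r j ∧ r j ≠ ∞)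
    (q s : ℝ≥0∞) (hq : 0 < q) (hq' : q ≠ ∞) (hqs : q < s)
    (p : Fin m → ℝ≥0∞) (hrp : ∀ j, r j < p j) (hps : (∑ j, (p j)⁻¹)⁻¹ < s) :
    ∃ C : ℝ≥0∞, 0 < C ∧ C ≠ ∞ ∧
      ∀ (T : (Fin m → ((Fin d → ℝ) → ℂ)) → ((Fin d → ℝ) → ℂ)) (C_T : ℝ≥0∞),
        (∀ f, (∀ j, SimpleLinftyC (f j)) → Measurable (T f)) →
        (∀ f g, (∀ j, SimpleLinftyC (f j)) → MemLinftyC g →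
          eNorm q volume (fun x => nn (T f) x * nn g x) ≤
            C_T * eNorm q volume
              (maximalX r (q⁻¹ - s⁻¹)⁻¹ (fun j => nn (f j)) (nn g))) →
        ∀ (w : Fin m → (Fin d → ℝ) → ℝ),
          (∀ j, Measurable (w j)) → (∀ j x, 0 < w j x) →
          aConst p r s w ≠ ∞ →
          ∀ f, (∀ j, SimpleLinftyC (f j)) →
            wNorm (∑ j, (p j)⁻¹)⁻¹ (fun x => ∏ j, w j x) (nn (T f)) ≤
              C * C_T * aConst p r s w ^
                ((max (⨆ j, (r j)⁻¹ / ((r j)⁻¹ - (p j)⁻¹))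
                  ((q⁻¹ - s⁻¹) / ((∑ j, (p j)⁻¹) - s⁻¹))).toReal) *
                ∏ j, wNorm (p j) (w j) (nn (f j)) := by
  have hri : ∀ j, (r j)⁻¹ ≠ ∞ := fun j => ENNReal.inv_ne_top.2 (hr j).1.ne'
  have hpi : ∀ j, (p j)⁻¹ ≠ ∞ := fun j => ENNReal.inv_ne_top.2 ((hr j).1.trans (hrp j)).ne'
  have hsmt : ∑ j, (p j)⁻¹ ≠ ∞ := ENNReal.sum_ne_top.2 fun j _ => hpi j
  have hsm0 : ∑ j, (p j)⁻¹ ≠ 0 := by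
    intro h
    rw [h, ENNReal.inv_zero] at hps
    exact not_top_lt hps
  have hrp' : ∀ j, (p j)⁻¹ < (r j)⁻¹ := fun j => ENNReal.inv_lt_inv.2 (hrp j)
  have hsq' : s⁻¹ < q⁻¹ := ENNReal.inv_lt_inv.2 hqs
  have hsp' : s⁻¹ < ∑ j, (p j)⁻¹ := by
    have := ENNReal.inv_lt_inv.2 hps
    rwa [inv_inv] at this
  have hqi : q⁻¹ ≠ ∞ := ENNReal.inv_ne_top.2 hq.ne'
  have Aj := fun j => S7.inv_sub (hri j) (hrp' j)
  obtain ⟨hρt, hρ, hSq, hρ0, hρ1, hρ2⟩ := S7.inv_sub hqi hsq'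
  obtain ⟨hθt, hθ, hSp, hθ0, hθ1, hθ2⟩ := S7.inv_sub hsmt hsp'
  set e : Fin m → ℝ := fun j => ((r j)⁻¹).toReal with he
  set P : Fin m → ℝ := fun j => ((p j)⁻¹).toReal with hPd
  set S := (s⁻¹).toReal with hSd
  have hS : 0 ≤ S := toReal_nonneg
  set pp := ((∑ j, (p j)⁻¹)⁻¹).toReal with hpp
  have hp : 0 < pp := ENNReal.toReal_pos (ENNReal.inv_ne_zero.2 hsmt) (ENNReal.inv_ne_top.2 hsm0)
  have hpt : (∑ j, (p j)⁻¹)⁻¹ ≠ ∞ := ENNReal.inv_ne_top.2 hsm0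
  have hsmp : (∑ j, (p j)⁻¹).toReal = 1 / pp := by rw [hpp, ENNReal.toReal_inv, one_div, inv_inv]
  have hPp : ∑ j, P j = 1 / pp := by
    rw [← hsmp, ENNReal.toReal_sum fun j _ => hpi j]
  have hqr : 0 < q.toReal := ENNReal.toReal_pos hq.ne' hq'
  have hqe : (q⁻¹).toReal = 1 / q.toReal := by rw [ENNReal.toReal_inv, one_div]
  rw [hsmp] at hSp hθ hθ2
  rw [hqe] at hSq hρ hρ2
  have hP : ∀ j, 0 ≤ P j := fun j => toReal_nonneg
  have hPe : ∀ j, P j < e j := fun j => (Aj j).2.2.1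
  have he0 : ∀ j, 0 < e j := fun j => (hP j).trans_lt (hPe j)
  have hre : ∀ j, (r j).toReal = 1 / e j := fun j => by
    simp only [he]
    rw [ENNReal.toReal_inv, one_div, inv_inv]
  set Mx := max (⨆ j, (r j)⁻¹ / ((r j)⁻¹ - (p j)⁻¹)) ((q⁻¹ - s⁻¹) / ((∑ j, (p j)⁻¹) - s⁻¹)) with hMx
  have hMt : Mx ≠ ∞ := by
    have hj : ∀ j, (r j)⁻¹ / ((r j)⁻¹ - (p j)⁻¹) < ∞ := fun j =>
      (ENNReal.div_ne_top (hri j) (Aj j).2.2.2.1).lt_top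
    have : (⨆ j, (r j)⁻¹ / ((r j)⁻¹ - (p j)⁻¹)) < ∞ := by
      rw [← Finset.sup_univ_eq_iSup, Finset.sup_lt_iff (by simp)]
      exact fun j _ => hj j
    exact (max_lt this (ENNReal.div_ne_top hρ1 hθ0).lt_top).ne
  set γ := Mx.toReal with hγd
  have hγ : ∀ j, e j ≤ γ * (e j - P j) := by
    intro j
    have h1 : (r j)⁻¹ / ((r j)⁻¹ - (p j)⁻¹) ≤ Mx :=
      (le_iSup (fun j => (r j)⁻¹ / ((r j)⁻¹ - (p j)⁻¹)) j).trans (le_max_left _ _)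
    have h2 := ENNReal.toReal_mono hMt h1
    rw [ENNReal.toReal_div, (Aj j).2.2.2.2.2] at h2
    exact (div_le_iff₀ (sub_pos.2 (hPe j))).1 h2
  have hγ0 : 1 / q.toReal - S ≤ γ * (1 / pp - S) := by
    have h2 := ENNReal.toReal_mono hMt (le_max_right _ _ : (q⁻¹ - s⁻¹) / ((∑ j, (p j)⁻¹) - s⁻¹) ≤ Mx)
    rw [ENNReal.toReal_div, hρ2, hθ2] at h2
    exact (div_le_iff₀ (sub_pos.2 hSp)).1 h2
  have hγ1 : 1 ≤ γ := by
    have j : Fin m := ⟨0, hm⟩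
    have h1 := hγ j
    have h2 := hP j
    have h3 := hPe j
    by_contra hlt
    push Not at hlt
    nlinarith
  obtain ⟨c, hct, hc⟩ := S7.core (d := d) hP hPe hqr hp hPp hS hSp hSq hγ1 hγ hγ0
  set c6 : ℝ≥0∞ := ((∏ j, ((6:ℝ≥0∞) ^ d) ^ e j) * ((6:ℝ≥0∞) ^ d) ^ (1 / q.toReal - S)) with hc6
  have h6 : ((6:ℝ≥0∞) ^ d) ≠ ∞ := ENNReal.pow_ne_top (by simp)
  have hc6t : c6 ≠ ∞ := ENNReal.mul_ne_top
    (ENNReal.prod_ne_top fun j _ => ENNReal.rpow_ne_top_of_nonneg (he0 j).le h6)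
    (ENNReal.rpow_ne_top_of_nonneg (by linarith) h6)
  refine ⟨c * c6 + 1, by simp, ENNReal.add_ne_top.2 ⟨ENNReal.mul_ne_top hct hc6t, by simp⟩, ?_⟩
  intro T C_T hTm hT w hwm hw hK f hf
  have hnnm : ∀ g : (Fin d → ℝ) → ℂ, Measurable g → Measurable (nn g) := fun g hg =>
    hg.nnnorm.coe_nnreal_ennreal
  have hω0 : ∀ j x, ENNReal.ofReal (w j x) ≠ 0 := fun j x => (ENNReal.ofReal_pos.2 (hw j x)).ne'
  have hprod : ∀ x, ENNReal.ofReal (∏ j, w j x) = ∏ j, ENNReal.ofReal (w j x) := fun x =>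
    ENNReal.ofReal_prod_of_nonneg fun j _ => (hw j x).le
  have key := hc (fun j x => ENNReal.ofReal (w j x)) (fun j => (hwm j).ennreal_ofReal) hω0
    (fun j x => ENNReal.ofReal_ne_top) (aConst p r s w) hK ?_ (fun j => nn (f j)) (fun j => hnnm _ (hf j).1)
    (fun j => wNorm (p j) (w j) (nn (f j))) ?_ (nn (T f)) (hnnm _ (hTm f hf)) (C_T * c6)
    (S7.hypT he0 (sub_pos.2 hSq) hqr hq' (fun j => (hr j).2) hre hρt hρ _ (hnnm _ (hTm f hf))
      fun g hg => hT f g hf hg)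
  · unfold wNorm eNorm at key ⊢
    rw [if_neg hpt]
    simp only [hprod]
    refine key.trans ?_
    refine mul_le_mul_left (mul_le_mul_left ?_ _) _
    rw [add_mul]
    exact le_trans (le_of_eq (by ring)) le_self_add
  · intro α Q hQ
    obtain ⟨R, rfl⟩ := S7.grid_cube hQ
    refine le_trans (le_of_eq ?_) (le_iSup _ R)
    rw [mul_comm, S7.avg_eq hθt hθ]
    simp only [hprod]
    congr 1
    refine Finset.prod_congr rfl fun j _ => ?_
    rw [S7.avg_eq (Aj j).1 (Aj j).2.1]
    have : ∀ x, ENNReal.ofReal (w j x)⁻¹ ^ (1 / (e j - P j)) = ENNReal.ofReal (w j x) ^ (-1 / (e j - P j)) := by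
      intro x
      rw [ENNReal.ofReal_inv_of_pos (hw j x), ← ENNReal.rpow_neg_one, ← ENNReal.rpow_mul]
      congr 1
      ring
    simp only [← this]
    rfl
  · intro j
    by_cases hj : p j = ∞
    · right
      refine ⟨by simp [hPd, hj], ?_⟩
      unfold wNorm eNorm
      rw [if_pos hj]
      exact ae_le_essSup
    · left
      have hPj : 1 / P j = (p j).toReal := by
        simp only [hPd]
        rw [ENNReal.toReal_inv, one_div, inv_inv]
      have hpj : 0 < (p j).toReal := ENNReal.toReal_pos ((hr j).1.trans (hrp j)).ne' hj
      refine ⟨one_div_pos.1 (hPj ▸ hpj), ?_⟩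
      unfold wNorm eNorm
      rw [if_neg hj, hPj, ← ENNReal.rpow_mul, one_div_mul_cancel hpj.ne', ENNReal.rpow_one]

end
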